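/- arXiv:math/0502403 — 11 statements merged into one kernel-verified Lean document; each statement's English description precedes it below -/
import Mathlib

section
/- Let C be a skeletally small abelian category and fix objects X, Y, Z, M of C, together with a set R of representatives of the isomorphism classes of objects of C. Then there is a bijection between the disjoint union, over L ∈ R, of the orbit sets (W_{XY}^L × W_{LZ}^M)/Aut(X,Y,Z,L) and the disjoint union, over L' ∈ R, of the orbit sets (W_{XL'}^M × W_{YZ}^{L'})/Aut(X,Y,Z,L'). -/
open CategoryTheory CategoryTheory.Limits

universe v u

namespace HallExact

variable {C : Type u} [Category.{v} C] [Abelian C]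

/-- `(f, g)` forms a short exact sequence `0 → Y → L → X → 0`. -/
def IsSES {X Y L : C} (f : Y ⟶ L) (g : L ⟶ X) : Prop :=
  ∃ w : f ≫ g = 0, (ShortComplex.mk f g w).ShortExact

/-- `W X Y L` is the set of short exact sequences `0 → Y → L → X → 0`. -/
def W (X Y L : C) : Type v :=
  {p : (Y ⟶ L) × (L ⟶ X) // IsSES p.1 p.2}

/-- The orbit relation on `W_{XY}^L × W_{LZ}^M` for the action of
`Aut(X,Y,Z,L) = Aut X × Aut Y × Aut Z × Aut L`, where `(ξ,η,ζ,λ)` sends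
`((f,g),(l,m))` to `((λ∘f∘η⁻¹, ξ∘g∘λ⁻¹), (l∘ζ⁻¹, λ∘m))`. -/
def PairRel (X Y Z L M : C) (p q : W X Y L × W L Z M) : Prop :=
  ∃ (ξ : Aut X) (η : Aut Y) (ζ : Aut Z) (l : Aut L),
    q.1.1.1 = η.inv ≫ p.1.1.1 ≫ l.hom ∧
    q.1.1.2 = l.inv ≫ p.1.1.2 ≫ ξ.hom ∧
    q.2.1.1 = ζ.inv ≫ p.2.1.1 ∧
    q.2.1.2 = p.2.1.2 ≫ l.hom

/-- The orbit relation on `W_{XL'}^M × W_{YZ}^{L'}` for the dual action of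
`Aut(X,Y,Z,L')`, where `(ξ,η,ζ,λ')` sends `((f',g'),(l',m'))` to
`((f'∘λ'⁻¹, ξ∘g'), (λ'∘l'∘ζ⁻¹, η∘m'∘λ'⁻¹))`. -/
def PairRel' (X Y Z L' M : C) (p q : W X L' M × W Y Z L') : Prop :=
  ∃ (ξ : Aut X) (η : Aut Y) (ζ : Aut Z) (l : Aut L'),
    q.1.1.1 = l.inv ≫ p.1.1.1 ∧
    q.1.1.2 = p.1.1.2 ≫ ξ.hom ∧
    q.2.1.1 = ζ.inv ≫ p.2.1.1 ≫ l.hom ∧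
    q.2.1.2 = l.inv ≫ p.2.1.2 ≫ η.hom

theorem IsSES.zero {X Y L : C} {f : Y ⟶ L} {g : L ⟶ X} (h : IsSES f g) : f ≫ g = 0 := h.1

theorem IsSES.mono {X Y L : C} {f : Y ⟶ L} {g : L ⟶ X} (h : IsSES f g) : Mono f := h.2.mono_f

theorem IsSES.epi {X Y L : C} {f : Y ⟶ L} {g : L ⟶ X} (h : IsSES f g) : Epi g := h.2.epi_g

theorem IsSES.lift {X Y L : C} {f : Y ⟶ L} {g : L ⟶ X} (h : IsSES f g) {A : C} (k : A ⟶ L)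
    (hk : k ≫ g = 0) : ∃ t : A ⟶ Y, t ≫ f = k := by
  have := h.mono
  exact ⟨h.2.exact.lift k hk, h.2.exact.lift_f k hk⟩

theorem IsSES.desc {X Y L : C} {f : Y ⟶ L} {g : L ⟶ X} (h : IsSES f g) {A : C} (k : L ⟶ A)
    (hk : f ≫ k = 0) : ∃ t : X ⟶ A, g ≫ t = k := by
  have := h.epi
  exact ⟨h.2.exact.desc k hk, h.2.exact.g_desc k hk⟩

theorem isSES_of_lift {X Y L : C} (f : Y ⟶ L) (g : L ⟶ X) [Mono f] [Epi g] (w : f ≫ g = 0)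
    (H : ∀ {A : C} (k : A ⟶ L), k ≫ g = 0 → ∃ t : A ⟶ Y, t ≫ f = k) : IsSES f g :=
  ⟨w, { exact := ShortComplex.exact_of_f_is_kernel _
          (KernelFork.IsLimit.ofι' f w fun k hk => ⟨(H k hk).choose, (H k hk).choose_spec⟩)
        mono_f := ‹_›
        epi_g := ‹_› }⟩

theorem isSES_of_desc {X Y L : C} (f : Y ⟶ L) (g : L ⟶ X) [Mono f] [Epi g] (w : f ≫ g = 0)
    (H : ∀ {A : C} (k : L ⟶ A), f ≫ k = 0 → ∃ t : X ⟶ A, g ≫ t = k) : IsSES f g :=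
  ⟨w, { exact := ShortComplex.exact_of_g_is_cokernel _
          (CokernelCofork.IsColimit.ofπ' g w fun k hk => ⟨(H k hk).choose, (H k hk).choose_spec⟩)
        mono_f := ‹_›
        epi_g := ‹_› }⟩

/-- The two pairs of short exact sequences fit into one commutative diagram. -/
def Compat {X Y Z M L L' : C} (p : W X Y L × W L Z M) (q : W X L' M × W Y Z L') : Prop :=
  q.1.1.2 = p.2.1.2 ≫ p.1.1.2 ∧ p.2.1.1 = q.2.1.1 ≫ q.1.1.1 ∧
    q.1.1.1 ≫ p.2.1.2 = q.2.1.2 ≫ p.1.1.1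

theorem exists_right {X Y Z M L L' : C} (p : W X Y L × W L Z M)
    (i : L' ≅ pullback p.2.1.2 p.1.1.1) : ∃ q : W X L' M × W Y Z L', Compat p q := by
  obtain ⟨⟨⟨f, g⟩, h⟩, ⟨⟨l, m⟩, h'⟩⟩ := p
  dsimp only at h h' i
  have := h.mono
  have := h.epi
  have := h'.mono
  have := h'.epi
  have P : IsPullback (i.hom ≫ pullback.fst m f) (i.hom ≫ pullback.snd m f) m f :=
    IsPullback.of_iso_pullback ⟨by simp [pullback.condition]⟩ i rfl rfl
  have m1 : Mono (i.hom ≫ pullback.fst m f) := inferInstance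
  have e1 : Epi (i.hom ≫ pullback.snd m f) := inferInstance
  generalize i.hom ≫ pullback.fst m f = f' at *
  generalize i.hom ≫ pullback.snd m f = m' at *
  have hl : P.lift l 0 (by simp [h'.zero]) ≫ f' = l := P.lift_fst _ _ _
  have hl2 : P.lift l 0 (by simp [h'.zero]) ≫ m' = 0 := P.lift_snd _ _ _
  generalize P.lift l 0 (by simp [h'.zero]) = l' at *
  have : Mono (l' ≫ f') := by rw [hl]; infer_instance
  have : Mono l' := mono_of_mono l' f'
  refine ⟨(⟨(f', m ≫ g), ?_⟩, ⟨(l', m'), ?_⟩), rfl, hl.symm, P.w⟩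
  · have : Epi (m ≫ g) := epi_comp _ _
    refine isSES_of_lift f' (m ≫ g) ?_ fun k hk => ?_
    · rw [← Category.assoc, P.w, Category.assoc, h.zero, comp_zero]
    · obtain ⟨t, ht⟩ := h.lift (k ≫ m) (by simpa using hk)
      exact ⟨P.lift k t ht.symm, P.lift_fst _ _ _⟩
  · refine isSES_of_lift l' m' hl2 fun k hk => ?_
    obtain ⟨t, ht⟩ := h'.lift (k ≫ f') (by
      rw [Category.assoc, P.w, ← Category.assoc, hk, zero_comp])
    refine ⟨t, ?_⟩
    rw [← cancel_mono f', Category.assoc, hl, ht]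

theorem exists_left {X Y Z M L L' : C} (q : W X L' M × W Y Z L')
    (i : pushout q.1.1.1 q.2.1.2 ≅ L) : ∃ p : W X Y L × W L Z M, Compat p q := by
  obtain ⟨⟨⟨f', g'⟩, h⟩, ⟨⟨l', m'⟩, h'⟩⟩ := q
  dsimp only at h h' i
  have := h.mono
  have := h.epi
  have := h'.mono
  have := h'.epi
  have P : IsPushout f' m' (pushout.inl f' m' ≫ i.hom) (pushout.inr f' m' ≫ i.hom) :=
    IsPushout.of_iso_pushout ⟨by simp [pushout.condition_assoc]⟩ i.symm (by simp) (by simp)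
  have m1 : Epi (pushout.inl f' m' ≫ i.hom) := inferInstance
  have e1 : Mono (pushout.inr f' m' ≫ i.hom) := inferInstance
  generalize pushout.inl f' m' ≫ i.hom = m at *
  generalize pushout.inr f' m' ≫ i.hom = f at *
  have hl : m ≫ P.desc g' 0 (by simp [h.zero]) = g' := P.inl_desc _ _ _
  have hl2 : f ≫ P.desc g' 0 (by simp [h.zero]) = 0 := P.inr_desc _ _ _
  generalize P.desc g' 0 (by simp [h.zero]) = g at *
  have : Epi (m ≫ g) := by rw [hl]; infer_instance
  have : Epi g := epi_of_epi m g
  refine ⟨(⟨(f, g), ?_⟩, ⟨(l' ≫ f', m), ?_⟩), hl.symm, rfl, P.w⟩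
  · refine isSES_of_desc f g hl2 fun k hk => ?_
    obtain ⟨t, ht⟩ := h.desc (m ≫ k) (by
      rw [← Category.assoc, P.w, Category.assoc, hk, comp_zero])
    refine ⟨t, ?_⟩
    rw [← cancel_epi m, ← Category.assoc, hl, ht]
  · have : Mono (l' ≫ f') := mono_comp _ _
    refine isSES_of_desc (l' ≫ f') m ?_ fun k hk => ?_
    · rw [Category.assoc, P.w, ← Category.assoc, h'.zero, zero_comp]
    · obtain ⟨t, ht⟩ := h'.desc (f' ≫ k) (by simpa using hk)
      exact ⟨P.desc k t ht.symm, P.inl_desc _ _ _⟩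

theorem eq_right (R : Set C) (hR : ∀ A : C, ∃! B, B ∈ R ∧ Nonempty (A ≅ B)) {X Y Z M L : C}
    {L₁ L₂ : R} {p₁ p₂ : W X Y L × W L Z M} (hp : PairRel X Y Z L M p₁ p₂)
    {q₁ : W X (L₁ : C) M × W Y Z (L₁ : C)} {q₂ : W X (L₂ : C) M × W Y Z (L₂ : C)}
    (h₁ : Compat p₁ q₁) (h₂ : Compat p₂ q₂) :
    (⟨L₁, Quot.mk _ q₁⟩ : Σ L' : R, Quot (PairRel' X Y Z (L' : C) M)) = ⟨L₂, Quot.mk _ q₂⟩ := by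
  obtain ⟨(ξ : X ≅ X), (η : Y ≅ Y), (ζ : Z ≅ Z), (l : L ≅ L), e1, e2, e3, e4⟩ := hp
  obtain ⟨a1, a2, a3⟩ := h₁
  obtain ⟨b1, b2, b3⟩ := h₂
  have k1 : q₂.1.1.2 = q₁.1.1.2 ≫ ξ.hom := by simp [a1, b1, e2, e4]
  have k2 : q₁.1.1.2 = q₂.1.1.2 ≫ ξ.inv := by simp [k1]
  have := q₁.1.2.mono
  have := q₂.1.2.mono
  have := p₂.1.2.mono
  obtain ⟨s, hs⟩ := q₂.1.2.lift q₁.1.1.1 (by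
    rw [k1, ← Category.assoc, q₁.1.2.zero, zero_comp])
  obtain ⟨t, ht⟩ := q₁.1.2.lift q₂.1.1.1 (by
    rw [k2, ← Category.assoc, q₂.1.2.zero, zero_comp])
  let θ : (L₁ : C) ≅ L₂ := ⟨s, t, by rw [← cancel_mono q₁.1.1.1]; simp [hs, ht],
    by rw [← cancel_mono q₂.1.1.1]; simp [hs, ht]⟩
  obtain rfl : L₁ = L₂ :=
    Subtype.ext ((hR L₁).unique ⟨L₁.2, ⟨Iso.refl _⟩⟩ ⟨L₂.2, ⟨θ⟩⟩)
  congr 1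
  refine Quot.sound ⟨ξ, η, ζ, θ, ht.symm, k1, ?_, ?_⟩
  · rw [← cancel_mono q₂.1.1.1, ← b2, e3, a2]
    simp [θ, hs]
  · rw [← cancel_mono p₂.1.1.1, ← b3, e1, e4, ← ht]
    simp only [θ, Category.assoc, Iso.hom_inv_id_assoc]
    rw [← Category.assoc q₁.1.1.1, a3, Category.assoc]

theorem eq_left (R : Set C) (hR : ∀ A : C, ∃! B, B ∈ R ∧ Nonempty (A ≅ B)) {X Y Z M L' : C}
    {L₁ L₂ : R} {q₁ q₂ : W X L' M × W Y Z L'} (hq : PairRel' X Y Z L' M q₁ q₂)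
    {p₁ : W X Y (L₁ : C) × W (L₁ : C) Z M} {p₂ : W X Y (L₂ : C) × W (L₂ : C) Z M}
    (h₁ : Compat p₁ q₁) (h₂ : Compat p₂ q₂) :
    (⟨L₁, Quot.mk _ p₁⟩ : Σ L : R, Quot (PairRel X Y Z (L : C) M)) = ⟨L₂, Quot.mk _ p₂⟩ := by
  obtain ⟨(ξ : X ≅ X), (η : Y ≅ Y), (ζ : Z ≅ Z), (l : L' ≅ L'), e1, e2, e3, e4⟩ := hq
  obtain ⟨a1, a2, a3⟩ := h₁
  obtain ⟨b1, b2, b3⟩ := h₂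
  have k1 : p₂.2.1.1 = ζ.inv ≫ p₁.2.1.1 := by simp [a2, b2, e1, e3]
  have k2 : p₁.2.1.1 = ζ.hom ≫ p₂.2.1.1 := by simp [k1]
  have := p₁.2.2.epi
  have := p₂.2.2.epi
  have := q₂.2.2.epi
  obtain ⟨s, hs⟩ := p₁.2.2.desc p₂.2.1.2 (by
    rw [k2, Category.assoc, p₂.2.2.zero, comp_zero])
  obtain ⟨t, ht⟩ := p₂.2.2.desc p₁.2.1.2 (by
    rw [k1, Category.assoc, p₁.2.2.zero, comp_zero])
  let θ : (L₁ : C) ≅ L₂ := ⟨s, t,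
    by rw [← cancel_epi p₁.2.1.2, ← Category.assoc, hs, ht, Category.comp_id],
    by rw [← cancel_epi p₂.2.1.2, ← Category.assoc, ht, hs, Category.comp_id]⟩
  obtain rfl : L₁ = L₂ :=
    Subtype.ext ((hR L₁).unique ⟨L₁.2, ⟨Iso.refl _⟩⟩ ⟨L₂.2, ⟨θ⟩⟩)
  congr 1
  refine Quot.sound ⟨ξ, η, ζ, θ, ?_, ?_, k1, hs.symm⟩
  · rw [← cancel_epi q₂.2.1.2, ← b3, e1, e4, ← hs]
    simp only [θ, Category.assoc, Iso.hom_inv_id_assoc]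
    rw [← Category.assoc q₁.1.1.1, a3, Category.assoc]
  · rw [← cancel_epi p₂.2.1.2, ← b1, e2, a1]
    simp only [θ, Category.assoc]
    rw [← Category.assoc p₂.2.1.2 t, ht]

theorem PairRel.refl {X Y Z L M : C} (p : W X Y L × W L Z M) : PairRel X Y Z L M p p :=
  ⟨Iso.refl _, Iso.refl _, Iso.refl _, Iso.refl _, by simp, by simp, by simp, by simp⟩

theorem PairRel'.refl {X Y Z L M : C} (p : W X L M × W Y Z L) : PairRel' X Y Z L M p p :=
  ⟨Iso.refl _, Iso.refl _, Iso.refl _, Iso.refl _, by simp, by simp, by simp, by simp⟩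

/-- Proposition 1: given a set `R` of representatives of the isomorphism classes of
objects, there is a bijection between the disjoint union over `L ∈ R` of the orbit sets
`(W_{XY}^L × W_{LZ}^M)/Aut(X,Y,Z,L)` and the disjoint union over `L' ∈ R` of the orbit
sets `(W_{XL'}^M × W_{YZ}^{L'})/Aut(X,Y,Z,L')`. -/
theorem pair_orbit_bijection (R : Set C)
    (hR : ∀ A : C, ∃! B, B ∈ R ∧ Nonempty (A ≅ B)) (X Y Z M : C) :
    Nonempty ((Σ L : R, Quot (PairRel X Y Z (L : C) M)) ≃
      (Σ L' : R, Quot (PairRel' X Y Z (L' : C) M))) := by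
  have H1 : ∀ (L : R) (p : W X Y (L : C) × W (L : C) Z M),
      ∃ (L' : R) (q : W X (L' : C) M × W Y Z (L' : C)), Compat p q := by
    intro L p
    obtain ⟨B, ⟨hB, ⟨i⟩⟩, -⟩ := hR (pullback p.2.1.2 p.1.1.1)
    exact ⟨⟨B, hB⟩, exists_right p i.symm⟩
  have H2 : ∀ (L' : R) (q : W X (L' : C) M × W Y Z (L' : C)),
      ∃ (L : R) (p : W X Y (L : C) × W (L : C) Z M), Compat p q := by
    intro L' q
    obtain ⟨B, ⟨hB, ⟨i⟩⟩, -⟩ := hR (pushout q.1.1.1 q.2.1.2)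
    exact ⟨⟨B, hB⟩, exists_left q i⟩
  choose a φ hφ using H1
  choose b ψ hψ using H2
  refine ⟨⟨fun x => Quot.lift (fun p => ⟨a x.1 p, Quot.mk _ (φ x.1 p)⟩)
      (fun p₁ p₂ h => eq_right R hR h (hφ _ p₁) (hφ _ p₂)) x.2,
    fun y => Quot.lift (fun q => ⟨b y.1 q, Quot.mk _ (ψ y.1 q)⟩)
      (fun q₁ q₂ h => eq_left R hR h (hψ _ q₁) (hψ _ q₂)) y.2, ?_, ?_⟩⟩
  · rintro ⟨L, ⟨p⟩⟩
    exact eq_left R hR (PairRel'.refl _) (hψ _ (φ L p)) (hφ L p)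
  · rintro ⟨L, ⟨q⟩⟩
    exact eq_right R hR (PairRel.refl _) (hφ _ (ψ L q)) (hψ L q)

end HallExact
end

section
/- Let k be a finite field with q elements and let C be a skeletally small k-linear abelian category with finite Hom-sets. Let X and Y be indecomposable objects with X ≇ Y, and let L be a decomposable object with L ≇ X ⊕ Y. Then q − 1 divides F_{XY}^L. (The proof shows that the scalar group k* acts freely on the orbit set V_{XY}^L.) -/
open CategoryTheory CategoryTheory.Limits

universe v u

namespace HallExact

variable {k : Type} [Field k] [Fintype k]
variable {C : Type u} [Category.{v} C] [Abelian C] [Linear k C]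

/-- The orbit relation on `W X Y L` for the action of `Aut X × Aut Y`,
where `(ξ, η) • (f, g) = (f ∘ η⁻¹, ξ ∘ g)`. -/
def WRel (X Y L : C) (p q : W X Y L) : Prop :=
  ∃ (ξ : Aut X) (η : Aut Y),
    q.1.1 = η.inv ≫ p.1.1 ∧ q.1.2 = p.1.2 ≫ ξ.hom

/-- The Hall number `F_{XY}^L`, the number of orbits of `Aut X × Aut Y` on `W X Y L`. -/
noncomputable def F (X Y L : C) : ℕ :=
  Nat.card (Quot (WRel X Y L))

theorem idem_zero_or_one {Y : C} (hY : Indecomposable Y) (e : Y ⟶ Y) (he : e ≫ e = e) :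
    e = 0 ∨ e = 𝟙 Y := by
  obtain ⟨Z, i, p, h1, h2⟩ := IsIdempotentComplete.idempotents_split Y e he
  have he' : (𝟙 Y - e) ≫ (𝟙 Y - e) = 𝟙 Y - e := by simp [he]
  obtain ⟨Z', i', p', h1', h2'⟩ := IsIdempotentComplete.idempotents_split Y (𝟙 Y - e) he'
  have c1 : i ≫ p' = 0 := by
    have : i ≫ p' = i ≫ (p' ≫ i') ≫ p' := by simp [h1']
    rw [this, h2', ← h2]
    simp [reassoc_of% h1]
  have c2 : i' ≫ p = 0 := by
    have : i' ≫ p = i' ≫ (𝟙 Y - p' ≫ i') ≫ p := by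
      rw [h2', sub_sub_cancel, ← h2]; simp [h1]
    rw [this]
    simp [reassoc_of% h1']
  have iso : Y ≅ Z ⊞ Z' :=
    { hom := biprod.lift p p'
      inv := biprod.desc i i'
      hom_inv_id := by simp [h2, h2']
      inv_hom_id := by ext <;> simp [h1, h1', c1, c2] }
  rcases hY.2 Z Z' iso with h | h
  · left; rw [← h2, h.eq_of_src i 0, comp_zero]
  · right
    have : 𝟙 Y - e = 0 := by rw [← h2', h.eq_of_src i' 0, comp_zero]
    exact (sub_eq_zero.mp this).symm

theorem split_of_proj {X Y L : C} {f : Y ⟶ L} {g : L ⟶ X} (h : IsSES f g) (p : L ⟶ L)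
    (hf : f ≫ p = f) (hg : p ≫ g = 0) : Nonempty (L ≅ X ⊞ Y) := by
  obtain ⟨w, hS⟩ := h
  have := hS.mono_f
  have := hS.epi_g
  have hf' : Mono f := hS.mono_f
  have hl : (hS.exact.lift p hg) ≫ f = p := hS.exact.lift_f p hg
  set t : L ⟶ Y := hS.exact.lift p hg
  have ht : f ≫ t = 𝟙 Y := by
    rw [← cancel_mono f, Category.assoc, hl, hf, Category.id_comp]
  let s : (ShortComplex.mk f g w).Splitting :=
    ShortComplex.Splitting.ofExactOfRetraction _ hS.exact t ht hS.epi_g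
  exact ⟨s.isoBinaryBiproduct ≪≫ biprod.braiding _ _⟩

theorem zero_of_proj {X Y L : C} {f : Y ⟶ L} {g : L ⟶ X} (h : IsSES f g) (p : L ⟶ L)
    (hp : p ≫ p = p) (hf : f ≫ p = 0) (hg : p ≫ g = 0) : p = 0 := by
  obtain ⟨w, hS⟩ := h
  have := hS.mono_f
  have hl : (hS.exact.lift p hg) ≫ f = p := hS.exact.lift_f p hg
  rw [← hp]
  nth_rw 1 [← hl]
  rw [Category.assoc, hf, comp_zero]

/-- The key freeness step: a short exact sequence compatible with a nontrivial idempotent splits. -/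
theorem split_of_idem {X Y L : C} (hX : Indecomposable X) (hY : Indecomposable Y)
    {f : Y ⟶ L} {g : L ⟶ X} (h : IsSES f g) (p : L ⟶ L)
    (hp : p ≫ p = p) (h0 : p ≠ 0) (h1 : p ≠ 𝟙 L) (a : Y ⟶ Y) (b : X ⟶ X)
    (ha : a ≫ f = f ≫ p) (hb : g ≫ b = p ≫ g) : Nonempty (L ≅ X ⊞ Y) := by
  have hm : Mono f := h.2.mono_f
  have he : Epi g := h.2.epi_g
  have ha2 : a ≫ a = a := by
    rw [← cancel_mono f, Category.assoc, ha, reassoc_of% ha, hp]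
  have hb2 : b ≫ b = b := by
    rw [← cancel_epi g, reassoc_of% hb, hb, reassoc_of% hp]
  rcases idem_zero_or_one hY a ha2 with rfl | rfl <;>
    rcases idem_zero_or_one hX b hb2 with rfl | rfl
  · exact absurd (zero_of_proj h p hp (by simpa using ha.symm) (by simpa using hb.symm)) h0
  · refine split_of_proj h (𝟙 L - p) ?_ ?_
    · simp [← ha]
    · simp [← hb]
  · exact split_of_proj h p (by simpa using ha.symm) (by simpa using hb.symm)
  · refine absurd (zero_of_proj h (𝟙 L - p) (by simp [hp]) ?_ ?_) ?_
    · simp [← ha]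
    · simp [← hb]
    · intro h2; exact h1 (sub_eq_zero.mp h2).symm

/-- The endomorphism acting by `c` on the image of `p` and by `1` on its kernel. -/
def theta {L : C} (p : L ⟶ L) (c : k) : L ⟶ L := 𝟙 L + (c - 1) • p

theorem theta_one {L : C} (p : L ⟶ L) : theta p (1 : k) = 𝟙 L := by simp [theta]

theorem theta_mul {L : C} (p : L ⟶ L) (hp : p ≫ p = p) (c d : k) :
    theta p c ≫ theta p d = theta p (c * d) := by
  simp only [theta, Preadditive.add_comp, Preadditive.comp_add, Linear.smul_comp,
    Linear.comp_smul, hp, Category.id_comp, Category.comp_id]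
  module

/-- `theta` of a unit as an isomorphism. -/
def thetaIso {L : C} (p : L ⟶ L) (hp : p ≫ p = p) (c : kˣ) : L ≅ L where
  hom := theta p (c : k)
  inv := theta p ((c⁻¹ : kˣ) : k)
  hom_inv_id := by rw [theta_mul p hp]; simp [theta_one]
  inv_hom_id := by rw [theta_mul p hp]; simp [theta_one]

theorem isSES_twist {X Y L : C} {f : Y ⟶ L} {g : L ⟶ X} (h : IsSES f g) (e : L ≅ L) :
    IsSES (f ≫ e.hom) (e.inv ≫ g) := by
  obtain ⟨w, hS⟩ := h
  refine ⟨by simp [w], ?_⟩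
  have w' : (f ≫ e.hom) ≫ (e.inv ≫ g) = 0 := by simp [w]
  have i : ShortComplex.mk f g w ≅ ShortComplex.mk (f ≫ e.hom) (e.inv ≫ g) w' :=
    ShortComplex.isoMk (Iso.refl _) e (Iso.refl _) (by simp) (by simp)
  exact ShortComplex.shortExact_of_iso i hS

/-- The action of a scalar on short exact sequences. -/
def act {X Y L : C} (p : L ⟶ L) (hp : p ≫ p = p) (c : kˣ) (x : W X Y L) : W X Y L :=
  ⟨(x.1.1 ≫ (thetaIso p hp c).hom, (thetaIso p hp c).inv ≫ x.1.2), isSES_twist x.2 _⟩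

theorem act_one {X Y L : C} (p : L ⟶ L) (hp : p ≫ p = p) (x : W X Y L) :
    act p hp (1 : kˣ) x = x := by
  apply Subtype.ext
  apply Prod.ext <;> simp [act, thetaIso, theta_one]

theorem act_mul {X Y L : C} (p : L ⟶ L) (hp : p ≫ p = p) (c d : kˣ) (x : W X Y L) :
    act p hp (c * d) x = act p hp c (act p hp d x) := by
  apply Subtype.ext
  apply Prod.ext
  · simp [act, thetaIso, theta_mul p hp, mul_comm]
  · simp only [act, thetaIso]
    rw [← Category.assoc, theta_mul p hp, mul_inv, Units.val_mul]

theorem wrel_equiv (X Y L : C) : Equivalence (WRel X Y L) where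
  refl x := ⟨Iso.refl _, Iso.refl _, by simp, by simp⟩
  symm := by
    rintro x y ⟨ξ, η, h1, h2⟩
    refine ⟨Iso.symm ξ, Iso.symm η, ?_, ?_⟩
    · rw [h1]; exact (Iso.hom_inv_id_assoc η _).symm
    · rw [h2, Category.assoc]
      exact ((congrArg (x.1.2 ≫ ·) (Iso.hom_inv_id ξ)).trans (Category.comp_id _)).symm
  trans := by
    rintro x y z ⟨ξ, η, h1, h2⟩ ⟨ξ', η', h1', h2'⟩
    refine ⟨Iso.trans ξ ξ', Iso.trans η η', ?_, ?_⟩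
    · rw [h1', h1]; exact (Category.assoc _ _ _).symm
    · rw [h2', h2]; exact Category.assoc _ _ _

/-- The induced action of the unit group on orbits. -/
def actQuot {X Y L : C} (p : L ⟶ L) (hp : p ≫ p = p) : MulAction kˣ (Quot (WRel X Y L)) where
  smul c := Quot.map (act p hp c) (by
    rintro x y ⟨ξ, η, h1, h2⟩
    exact ⟨ξ, η, by simp [act, h1], by simp [act, h2]⟩)
  one_smul := by
    rintro ⟨x⟩
    exact congrArg (Quot.mk _) (act_one p hp x)
  mul_smul := by
    rintro c d ⟨x⟩
    exact congrArg (Quot.mk _) (act_mul p hp c d x)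

theorem act_free {X Y L : C} (hX : Indecomposable X) (hY : Indecomposable Y)
    (hLXY : ¬ Nonempty (L ≅ X ⊞ Y)) (p : L ⟶ L) (hp : p ≫ p = p) (h0 : p ≠ 0) (h1 : p ≠ 𝟙 L)
    (c : kˣ) (x : W X Y L) (h : WRel X Y L x (act p hp c x)) : c = 1 := by
  by_contra hc
  apply hLXY
  obtain ⟨ξ, η, e1, e2⟩ := h
  have hc1 : (c : k) - 1 ≠ 0 := fun hh => hc (Units.ext (by simpa using sub_eq_zero.mp hh))
  have hc2 : ((c⁻¹ : kˣ) : k) - 1 ≠ 0 := fun hh => hc (by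
    have : c⁻¹ = 1 := Units.ext (by simpa using sub_eq_zero.mp hh)
    simpa using this)
  simp only [act, thetaIso, theta] at e1 e2
  refine split_of_idem hX hY x.2 p hp h0 h1 (((c : k) - 1)⁻¹ • (η.inv - 𝟙 Y))
    ((((c⁻¹ : kˣ) : k) - 1)⁻¹ • (ξ.hom - 𝟙 X)) ?_ ?_
  · rw [Linear.smul_comp, Preadditive.sub_comp, ← e1]
    simp only [Preadditive.comp_add, Category.comp_id, Category.id_comp, add_sub_cancel_left,
      Linear.comp_smul]
    rw [smul_smul, inv_mul_cancel₀ hc1, one_smul]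
  · rw [Linear.comp_smul, Preadditive.comp_sub, ← e2]
    simp only [Preadditive.add_comp, Category.comp_id, Category.id_comp, add_sub_cancel_left,
      Linear.smul_comp]
    rw [smul_smul, inv_mul_cancel₀ hc2, one_smul]

theorem card_dvd_of_free {G α : Type*} [Group G] [MulAction G α]
    (h : ∀ (g : G) (a : α), g • a = a → g = 1) : Nat.card G ∣ Nat.card α := by
  have hs : ∀ a : α, MulAction.stabilizer G a = ⊥ := fun a => by
    rw [eq_bot_iff]; intro g hg; exact h g a hg
  rw [Nat.card_congr (MulAction.selfEquivOrbitsQuotientProd hs), Nat.card_prod]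
  exact dvd_mul_left _ _

/-- If `X` and `Y` are non-isomorphic indecomposables and `L` is decomposable with
`L ≇ X ⊞ Y`, then `q - 1` divides `F_{XY}^L`. -/
theorem hall_number_divisible (hHom : ∀ A B : C, Finite (A ⟶ B))
    (X Y L : C) (hX : Indecomposable X) (hY : Indecomposable Y)
    (hXY : ¬ Nonempty (X ≅ Y))
    (hL : ∃ A B : C, ¬ IsZero A ∧ ¬ IsZero B ∧ Nonempty (L ≅ A ⊞ B))
    (hLXY : ¬ Nonempty (L ≅ X ⊞ Y)) :
    (Fintype.card k - 1) ∣ F X Y L := by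
  obtain ⟨A, B, hA, hB, ⟨e⟩⟩ := hL
  let p : L ⟶ L := e.hom ≫ biprod.fst ≫ biprod.inl ≫ e.inv
  have hp : p ≫ p = p := by simp [p]
  have h0 : p ≠ 0 := fun h => hA ((IsZero.iff_id_eq_zero A).2 (by
    have : biprod.inl ≫ e.inv ≫ p ≫ e.hom ≫ biprod.fst = 𝟙 A := by simp [p]
    rw [← this, h]; simp))
  have h1 : p ≠ 𝟙 L := fun h => hB ((IsZero.iff_id_eq_zero B).2 (by
    have h2 : biprod.inr ≫ e.inv ≫ p ≫ e.hom ≫ biprod.snd = (0 : B ⟶ B) := by simp [p]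
    rw [h] at h2; simpa using h2))
  letI := actQuot (k := k) (X := X) (Y := Y) p hp
  have key := card_dvd_of_free (G := kˣ) (α := Quot (WRel X Y L)) (by
    rintro c ⟨x⟩ hx
    have hx' : Quot.mk (WRel X Y L) (act p hp c x) = Quot.mk _ x := hx
    exact act_free hX hY hLXY p hp h0 h1 c x
      ((wrel_equiv X Y L).symm (((wrel_equiv X Y L).quot_mk_eq_iff _ _).1 hx')))
  rwa [Nat.card_units, Nat.card_eq_fintype_card] at key

end HallExact
end

section
/- Let k be a finite field with q elements and let C be a skeletally small k-linear abelian category with finite Hom-sets. If X and Y are indecomposable objects with X ≇ Y, then F_{XY}^{X⊕Y} = |Hom(Y,X)|; that is, the orbit set V_{XY}^{X⊕Y} is in bijection with Hom(Y,X). -/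
open CategoryTheory CategoryTheory.Limits

universe v u

namespace HallExact

variable {k : Type} [Field k] [Fintype k]
variable {C : Type u} [Category.{v} C] [Abelian C] [Linear k C]

theorem isIso_of_split_aux {Z X : C} (hZ : Indecomposable Z) (hX : ¬ IsZero X)
    (s : X ⟶ Z) (r : Z ⟶ X) (h : s ≫ r = 𝟙 X) : IsIso r := by
  have : IsSplitEpi r := ⟨⟨s, h⟩⟩
  let S : ShortComplex C := ShortComplex.mk (kernel.ι r) r (kernel.condition r)
  have hS : S.Exact := ShortComplex.exact_of_f_is_kernel S (kernelIsKernel r)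
  have sp : S.Splitting := ShortComplex.Splitting.ofExactOfSection S hS s h
    (inferInstanceAs (Mono (kernel.ι r)))
  rcases hZ.2 _ _ sp.isoBinaryBiproduct with h0 | h0
  · haveI : Mono r := Preadditive.mono_of_kernel_zero (h0.eq_of_src _ _)
    exact isIso_of_mono_of_isSplitEpi r
  · exact absurd h0 hX

theorem idem_aux {X : C} (hX : Indecomposable X) (e : X ⟶ X) (he : e ≫ e = e) :
    e = 0 ∨ e = 𝟙 X := by
  by_cases h0 : e = 0
  · exact Or.inl h0
  right
  let p := factorThruImage e
  let i := image.ι e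
  have hpi : p ≫ i = e := image.fac e
  have hip : i ≫ p = 𝟙 _ := by
    rw [← cancel_epi p, ← cancel_mono i]
    simp only [Category.assoc, hpi, Category.id_comp]
    rw [← Category.assoc, hpi, he]
  have hne : ¬ IsZero (image e) := fun hz => h0 (by
    rw [← hpi, show i = 0 from hz.eq_of_src _ _, comp_zero])
  have := isIso_of_split_aux hX hne i p hip
  rw [← hpi, ← cancel_mono p, Category.assoc, hip, Category.comp_id, Category.id_comp]

theorem exists_pow_idem {M : Type*} [Monoid M] [Finite M] (a : M) :
    ∃ n : ℕ, 0 < n ∧ a ^ n * a ^ n = a ^ n := by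
  obtain ⟨m, n, hmn, h⟩ : ∃ m n : ℕ, m < n ∧ a ^ m = a ^ n := by
    obtain ⟨m, n, hne, h⟩ := Finite.exists_ne_map_eq_of_infinite (fun n : ℕ => a ^ n)
    rcases lt_or_gt_of_ne hne with h1 | h1
    · exact ⟨m, n, h1, h⟩
    · exact ⟨n, m, h1, h.symm⟩
  obtain ⟨p, hp, rfl⟩ : ∃ p, 0 < p ∧ n = m + p := ⟨n - m, by omega, by omega⟩
  have key : ∀ j : ℕ, a ^ (m + j * p) = a ^ m := by
    intro j
    induction j with
    | zero => simp
    | succ j ih =>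
      rw [show m + (j + 1) * p = (m + j * p) + p by ring, pow_add, ih, ← pow_add, ← h]
  refine ⟨(m + 1) * p, by positivity, ?_⟩
  obtain ⟨t, ht⟩ : ∃ t, (m + 1) * p = m + t := ⟨(m + 1) * p - m, by
    have : m + 1 ≤ (m + 1) * p := Nat.le_mul_of_pos_right _ hp
    omega⟩
  have : (m + 1) * p + (m + 1) * p = (m + (m + 1) * p) + t := by omega
  rw [← pow_add, this, pow_add, key, ← pow_add, ht]

theorem unit_or_nilp {X : C} [Finite (X ⟶ X)] (hX : Indecomposable X) (a : End X) :
    IsUnit a ∨ IsNilpotent a := by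
  have : Finite (End X) := inferInstanceAs (Finite (X ⟶ X))
  obtain ⟨n, hn, h⟩ := exists_pow_idem a
  rcases idem_aux hX (a ^ n) h with h | h
  · exact Or.inr ⟨n, h⟩
  · left
    have h1 : a ^ n = 1 := h
    exact IsUnit.of_pow_eq_one h1 hn.ne'

theorem section_aux (hHom : ∀ A B : C, Finite (A ⟶ B)) {X Y : C}
    (f : Y ⟶ X ⊞ Y) (g : X ⊞ Y ⟶ X) (h : IsSES f g) : ∃ s : X ⟶ X ⊞ Y, s ≫ g = 𝟙 X := by
  obtain ⟨w, hS⟩ := h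
  have := hHom X (X ⊞ Y)
  have := hHom X X
  have := hHom X Y
  have : Mono f := hS.mono_f
  let φ : (X ⟶ X ⊞ Y) →+ (X ⟶ X) := Preadditive.rightComp X g
  have hφ : ∀ t, φ t = t ≫ g := fun _ => rfl
  have e1 : (X ⟶ X ⊞ Y) ≃ (X ⟶ X) × (X ⟶ Y) :=
    { toFun := fun t => (t ≫ biprod.fst, t ≫ biprod.snd)
      invFun := fun p => biprod.lift p.1 p.2
      left_inv := fun t => by ext <;> simp
      right_inv := fun p => by simp }
  have e2 : Nat.card φ.ker = Nat.card (X ⟶ Y) := by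
    refine (Nat.card_congr (Equiv.ofBijective
      (fun t : X ⟶ Y => (⟨t ≫ f, by
        rw [AddMonoidHom.mem_ker, hφ, Category.assoc, w, comp_zero]⟩ : φ.ker)) ⟨?_, ?_⟩)).symm
    · intro t t' htt
      exact (cancel_mono f).1 (congrArg Subtype.val htt)
    · rintro ⟨t, ht⟩
      rw [AddMonoidHom.mem_ker, hφ] at ht
      obtain ⟨l, hl⟩ := KernelFork.IsLimit.lift' hS.fIsKernel t ht
      exact ⟨l, Subtype.ext hl⟩
  have hc := AddSubgroup.card_mul_index φ.ker
  rw [AddSubgroup.index_ker, e2, Nat.card_congr e1, Nat.card_prod, mul_comm] at hc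
  have hc' := Nat.eq_of_mul_eq_mul_right Nat.card_pos hc
  have ht := AddSubgroup.eq_top_of_card_eq _ hc'
  obtain ⟨s, hs⟩ : 𝟙 X ∈ φ.range := by rw [ht]; trivial
  exact ⟨s, hs⟩

theorem isIso_inl_comp (hHom : ∀ A B : C, Finite (A ⟶ B))
    {X Y : C} (hX : Indecomposable X) (hY : Indecomposable Y)
    (hXY : ¬ Nonempty (X ≅ Y)) (f : Y ⟶ X ⊞ Y) (g : X ⊞ Y ⟶ X) (h : IsSES f g) :
    IsIso (biprod.inl ≫ g : X ⟶ X) := by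
  obtain ⟨s, hs⟩ := section_aux hHom f g h
  have := hHom X X
  let u : End X := (s ≫ biprod.fst) ≫ (biprod.inl ≫ g)
  let v : End X := (s ≫ biprod.snd) ≫ (biprod.inr ≫ g)
  have huv : u + v = 1 := by
    change (s ≫ biprod.fst) ≫ (biprod.inl ≫ g) + (s ≫ biprod.snd) ≫ (biprod.inr ≫ g) = 𝟙 X
    have h1 : (s ≫ biprod.fst) ≫ (biprod.inl ≫ g) + (s ≫ biprod.snd) ≫ (biprod.inr ≫ g) =
        s ≫ (biprod.fst ≫ biprod.inl + biprod.snd ≫ biprod.inr) ≫ g := by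
      simp only [Category.assoc, Preadditive.add_comp, Preadditive.comp_add]
    rw [h1, biprod.total, Category.id_comp, hs]
  rcases unit_or_nilp hX u with hu | hu
  · obtain ⟨t, ht⟩ := hu.exists_left_inv
    have hu' : IsIso ((s ≫ biprod.fst) ≫ (biprod.inl ≫ g)) := (isUnit_iff_isIso u).1 hu
    refine isIso_of_split_aux hX hX.1
      (inv ((s ≫ biprod.fst) ≫ (biprod.inl ≫ g)) ≫ (s ≫ biprod.fst)) _ ?_
    rw [Category.assoc, IsIso.inv_hom_id]
  · exfalso
    have hv : IsUnit v := by
      rw [show v = 1 - u from eq_sub_of_add_eq' huv]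
      exact hu.isUnit_one_sub
    have hv' : IsIso ((s ≫ biprod.snd) ≫ (biprod.inr ≫ g)) := (isUnit_iff_isIso v).1 hv
    have := isIso_of_split_aux hY hX.1
      (inv ((s ≫ biprod.snd) ≫ (biprod.inr ≫ g)) ≫ (s ≫ biprod.snd)) (biprod.inr ≫ g) (by
        rw [Category.assoc, IsIso.inv_hom_id])
    exact hXY ⟨(asIso (biprod.inr ≫ g : Y ⟶ X)).symm⟩

theorem ses_of_hom {X Y : C} (h : Y ⟶ X) :
    IsSES (biprod.lift (-h) (𝟙 Y) : Y ⟶ X ⊞ Y) (biprod.desc (𝟙 X) h) := by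
  refine ⟨by simp, ShortComplex.Splitting.shortExact
    { r := biprod.snd, s := biprod.inl, f_r := by simp, s_g := by simp, id := ?_ }⟩
  dsimp
  ext <;> simp

theorem rel_of_eq {X Y L : C} (p q : W X Y L) (ξ : X ≅ X)
    (h : q.1.2 = p.1.2 ≫ ξ.hom) : WRel X Y L p q := by
  obtain ⟨⟨f, g⟩, w, hS⟩ := p
  obtain ⟨⟨f', g'⟩, w', hS'⟩ := q
  dsimp only at h w w'
  have : Mono f := hS.mono_f
  have : Mono f' := hS'.mono_f
  have h1 : f' ≫ g = 0 := by
    rw [← cancel_mono ξ.hom, Category.assoc, ← h, w', zero_comp]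
  have h2 : f ≫ g' = 0 := by rw [h, ← Category.assoc, w, zero_comp]
  obtain ⟨l, hl⟩ := KernelFork.IsLimit.lift' hS.fIsKernel f' h1
  obtain ⟨l', hl'⟩ := KernelFork.IsLimit.lift' hS'.fIsKernel f h2
  change l ≫ f = f' at hl
  change l' ≫ f' = f at hl'
  refine ⟨ξ, ⟨l', l, ?_, ?_⟩, hl.symm, h⟩
  · rw [← cancel_mono f, Category.assoc, hl, hl', Category.id_comp]
  · rw [← cancel_mono f', Category.assoc, hl', hl, Category.id_comp]

theorem orbit_equiv (hHom : ∀ A B : C, Finite (A ⟶ B))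
    (X Y : C) (hX : Indecomposable X) (hY : Indecomposable Y)
    (hXY : ¬ Nonempty (X ≅ Y)) :
    Nonempty (Quot (WRel X Y (X ⊞ Y)) ≃ (Y ⟶ X)) := by
  have iso : ∀ p : W X Y (X ⊞ Y), IsIso (biprod.inl ≫ p.1.2 : X ⟶ X) := fun p =>
    isIso_inl_comp hHom hX hY hXY p.1.1 p.1.2 p.2
  let Φ : W X Y (X ⊞ Y) → (Y ⟶ X) := fun p =>
    have := iso p
    (biprod.inr ≫ p.1.2) ≫ inv (biprod.inl ≫ p.1.2)
  have hΦ : ∀ p t, Φ p = t ↔ biprod.inr ≫ p.1.2 = t ≫ biprod.inl ≫ p.1.2 := by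
    intro p t
    have := iso p
    exact IsIso.comp_inv_eq _
  have hrel : ∀ p q, WRel X Y (X ⊞ Y) p q → Φ p = Φ q := by
    rintro p q ⟨ξ, η, -, h⟩
    have hq := (hΦ q _).1 rfl
    have : IsIso ξ.hom := Iso.isIso_hom ξ
    refine (hΦ p _).2 ((cancel_mono ξ.hom).1 ?_)
    rw [h] at hq
    simpa only [Category.assoc] using hq
  refine ⟨Equiv.ofBijective (Quot.lift Φ hrel) ⟨?_, ?_⟩⟩
  · rintro ⟨p⟩ ⟨q⟩ hpq
    change Φ p = Φ q at hpq
    have := iso p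
    have := iso q
    have hp := (hΦ p _).1 hpq
    have hq := (hΦ q _).1 rfl
    refine Quot.sound (rel_of_eq p q
      ((asIso (biprod.inl ≫ p.1.2)).symm ≪≫ asIso (biprod.inl ≫ q.1.2)) ?_)
    simp only [Iso.trans_hom, Iso.symm_hom, asIso_inv, asIso_hom]
    apply biprod.hom_ext'
    · rw [← Category.assoc, ← Category.assoc, IsIso.hom_inv_id, Category.id_comp]
    · refine hq.trans (Eq.symm ?_)
      rw [← Category.assoc, hp, Category.assoc, IsIso.hom_inv_id_assoc]
  · intro h
    refine ⟨Quot.mk _ ⟨(biprod.lift (-h) (𝟙 Y), biprod.desc (𝟙 X) h), ses_of_hom h⟩, ?_⟩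
    refine (hΦ _ _).2 ?_
    simp

/-- If `X ≇ Y` are indecomposable, then `F_{XY}^{X ⊞ Y} = |Hom(Y,X)|`; indeed the orbit
set `V_{XY}^{X ⊞ Y}` is in bijection with `Hom(Y, X)`. -/
theorem hall_number_split (hHom : ∀ A B : C, Finite (A ⟶ B))
    (X Y : C) (hX : Indecomposable X) (hY : Indecomposable Y)
    (hXY : ¬ Nonempty (X ≅ Y)) :
    F X Y (X ⊞ Y) = Nat.card (Y ⟶ X) ∧
    Nonempty (Quot (WRel X Y (X ⊞ Y)) ≃ (Y ⟶ X)) := by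
  have h := orbit_equiv hHom X Y hX hY hXY
  exact ⟨Nat.card_congr h.some, h⟩

end HallExact
end

section
/- Let C be a pretriangulated category with shift functor T, and let Y →f M ⊕ P →g X →h TY be a distinguished triangle in which the component of f into P vanishes, i.e. f = ι_M ∘ f' for some f' : Y → M, where ι_M : M → M ⊕ P is the canonical inclusion. Then there exist an object N and morphisms g' : M → N, h' : N → TY such that Y →f' M →g' N →h' TY is a distinguished triangle and the original triangle is isomorphic (as a triangle) to the direct sum of the triangle (f', g', h') with the contractible triangle 0 → P →id P → 0; in particular X ≅ N ⊕ P. -/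
open CategoryTheory CategoryTheory.Limits CategoryTheory.Pretriangulated

universe v u

namespace HallTri

variable {C : Type u} [Category.{v} C] [HasZeroObject C] [HasShift C ℤ] [Preadditive C]
  [∀ n : ℤ, (shiftFunctor C n).Additive] [Pretriangulated C] [HasBinaryBiproducts C]

lemma complete_aux {Y L L' X X' : C} {f : Y ⟶ L} {g : L ⟶ X} {h : X ⟶ Y⟦(1 : ℤ)⟧}
    {f₂ : Y ⟶ L'} {g₂ : L' ⟶ X'} {h₂ : X' ⟶ Y⟦(1 : ℤ)⟧}
    (ht : Triangle.mk f g h ∈ distTriang C) (ht₂ : Triangle.mk f₂ g₂ h₂ ∈ distTriang C)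
    (w : L ⟶ L') (hw : f ≫ w = f₂) :
    ∃ a : X ⟶ X', g ≫ a = w ≫ g₂ ∧ a ≫ h₂ = h := by
  obtain ⟨a, ha1, ha2⟩ := complete_distinguished_triangle_morphism _ _ ht ht₂ (𝟙 Y) w
    (hw.trans (Category.id_comp f₂).symm)
  have ha3 : h ≫ (𝟙 Y)⟦(1 : ℤ)⟧' = a ≫ h₂ := ha2
  have e : h ≫ (𝟙 Y)⟦(1 : ℤ)⟧' = h := by simp
  exact ⟨a, ha1, ha3.symm.trans e⟩

lemma isIso_aux {Y L X : C} {f : Y ⟶ L} {g : L ⟶ X} {h : X ⟶ Y⟦(1 : ℤ)⟧}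
    (ht : Triangle.mk f g h ∈ distTriang C) (p : X ⟶ X) (h1 : g ≫ p = g) (h2 : p ≫ h = h) :
    IsIso p := by
  have e1 : f ≫ 𝟙 L = 𝟙 Y ≫ f := by simp
  have e2 : g ≫ p = 𝟙 L ≫ g := by simp [h1]
  have e3 : h ≫ (𝟙 Y)⟦(1 : ℤ)⟧' = p ≫ h := by simp [h2]
  exact isIso₃_of_isIso₁₂
    (Triangle.homMk (Triangle.mk f g h) (Triangle.mk f g h) (𝟙 Y) (𝟙 L) p e1 e2 e3) ht ht
    (inferInstanceAs (IsIso (𝟙 Y))) (inferInstanceAs (IsIso (𝟙 L)))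

lemma iso_aux {Y L X X' : C} {f : Y ⟶ L} {g : L ⟶ X} {h : X ⟶ Y⟦(1 : ℤ)⟧}
    {g₂ : L ⟶ X'} {h₂ : X' ⟶ Y⟦(1 : ℤ)⟧} (e : X ≅ X') (h1 : g ≫ e.hom = g₂)
    (h2 : e.hom ≫ h₂ = h) :
    Nonempty (Triangle.mk f g h ≅ Triangle.mk f g₂ h₂) := by
  have e1 : f ≫ 𝟙 L = 𝟙 Y ≫ f := by simp
  have e2 : g ≫ e.hom = 𝟙 L ≫ g₂ := by simp [h1]
  have e3 : h ≫ (𝟙 Y)⟦(1 : ℤ)⟧' = e.hom ≫ h₂ := by simp [h2]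
  exact ⟨Triangle.isoMk (Triangle.mk f g h) (Triangle.mk f g₂ h₂)
    (Iso.refl Y) (Iso.refl L) e e1 e2 e3⟩

/-- If `Y →f M ⊞ P →g X →h TY` is a distinguished triangle with the component of `f`
into `P` vanishing, i.e. `f = f' ≫ biprod.inl`, then there are `N`, `g' : M ⟶ N` and
`h' : N ⟶ TY` such that `(f', g', h')` is a distinguished triangle and the original
triangle is isomorphic to the direct sum of `(f', g', h')` with the contractible
triangle `0 → P → P → 0`; in particular `X ≅ N ⊞ P`. -/
theorem triangle_split_off (Y M P X : C)
    (f : Y ⟶ M ⊞ P) (g : M ⊞ P ⟶ X) (h : X ⟶ Y⟦(1 : ℤ)⟧)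
    (ht : Triangle.mk f g h ∈ distTriang C)
    (f' : Y ⟶ M) (hf : f = f' ≫ biprod.inl) :
    ∃ (N : C) (g' : M ⟶ N) (h' : N ⟶ Y⟦(1 : ℤ)⟧),
      Triangle.mk f' g' h' ∈ (distTriang C) ∧
      Nonempty (Triangle.mk f g h ≅
        Triangle.mk (f' ≫ biprod.inl) (biprod.map g' (𝟙 P))
          ((biprod.fst : N ⊞ P ⟶ N) ≫ h')) ∧
      Nonempty (X ≅ N ⊞ P) := by
  subst hf
  obtain ⟨N, g', h', ht'⟩ := distinguished_cocone_triangle f'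
  have hgh : g ≫ h = 0 := comp_distTriang_mor_zero₂₃ _ ht
  have hB : ∃ b : X ⟶ P, biprod.snd = g ≫ b := by
    have e : (f' ≫ (biprod.inl : M ⟶ M ⊞ P)) ≫ biprod.snd = 0 := by simp
    exact Triangle.yoneda_exact₂ _ ht (biprod.snd : M ⊞ P ⟶ P) e
  obtain ⟨a, ha1, ha2⟩ := complete_aux ht ht' biprod.fst (by simp)
  obtain ⟨c, hc1, hc2⟩ := complete_aux ht' ht biprod.inl rfl
  obtain ⟨b, hb⟩ := hB
  replace hb := hb.symm
  have hca : IsIso (c ≫ a) := isIso_aux ht' _ (by simp [reassoc_of% hc1, ha1])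
    (by simp [ha2, hc2])
  have hiso : IsIso (biprod.lift a b ≫ biprod.desc c (biprod.inr ≫ g)) := by
    refine isIso_aux ht _ ?_ ?_
    · rw [biprod.lift_desc, Preadditive.comp_add, reassoc_of% ha1, hc1, reassoc_of% hb]
      simp only [← Category.assoc, ← Preadditive.add_comp, biprod.total, Category.id_comp]
    · simp [biprod.lift_desc, hgh, hc2, ha2]
  have hmono : Mono (biprod.lift a b) := mono_of_mono _ (biprod.desc c (biprod.inr ≫ g))
  have hsplit : biprod.desc (inv (c ≫ a) ≫ (c - c ≫ b ≫ biprod.inr ≫ g)) (biprod.inr ≫ g) ≫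
      biprod.lift a b = 𝟙 _ := by
    have h1 : (c - c ≫ b ≫ biprod.inr ≫ g) ≫ a = c ≫ a := by
      simp [Preadditive.sub_comp, ha1]
    have h2 : (c - c ≫ b ≫ biprod.inr ≫ g) ≫ b = 0 := by
      simp [Preadditive.sub_comp, hb]
    apply biprod.hom_ext' <;> apply biprod.hom_ext
    · rw [biprod.inl_desc_assoc, Category.assoc, Category.assoc, biprod.lift_fst, h1,
        IsIso.inv_hom_id]
      simp
    · rw [biprod.inl_desc_assoc, Category.assoc, Category.assoc, biprod.lift_snd, h2]
      simp
    · simp [ha1]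
    · simp [hb]
  have hse : IsSplitEpi (biprod.lift a b) := IsSplitEpi.mk' ⟨_, hsplit⟩
  have hφ : IsIso (biprod.lift a b) := isIso_of_mono_of_isSplitEpi _
  refine ⟨N, g', h', ht', iso_aux (asIso (biprod.lift a b)) ?_ ?_, ⟨asIso (biprod.lift a b)⟩⟩
  · apply biprod.hom_ext <;> simp [ha1, hb]
  · simp [ha2]

end HallTri
end

section
/- Let C be a triangulated category with shift functor T in which every Hom-set is finite, and let Y →f L →g X →h TY be a distinguished triangle with L ≅ X ⊕ Y. Then h = 0, i.e. the triangle is split (isomorphic to the triangle Y → X ⊕ Y → X with canonical inclusion and projection and zero connecting morphism). -/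
open CategoryTheory CategoryTheory.Limits CategoryTheory.Pretriangulated

universe v u

namespace HallTri

variable {C : Type u} [Category.{v} C] [HasZeroObject C] [HasShift C ℤ] [Preadditive C]
  [∀ n : ℤ, (shiftFunctor C n).Additive] [Pretriangulated C] [IsTriangulated C]
  [HasBinaryBiproducts C]

/-- In a triangulated category with finite Hom-sets, any distinguished triangle
`Y →f L →g X →h TY` with `L ≅ X ⊞ Y` is split: `h = 0`. -/
theorem split_of_middle_iso (hHom : ∀ A B : C, Finite (A ⟶ B))
    (X Y L : C) (f : Y ⟶ L) (g : L ⟶ X) (h : X ⟶ Y⟦(1 : ℤ)⟧)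
    (ht : Triangle.mk f g h ∈ distTriang C)
    (hL : Nonempty (L ≅ X ⊞ Y)) :
    h = 0 := by
  obtain ⟨e⟩ := hL
  haveI := hHom
  let G : (X ⟶ L) →+ (X ⟶ X) := Preadditive.rightComp X g
  have hG : ∀ a, G a = a ≫ g := fun a => rfl
  have h1 : Nat.card (X ⟶ L) = Nat.card (X ⟶ X) * Nat.card (X ⟶ Y) := by
    rw [← Nat.card_prod]
    refine Nat.card_congr
      { toFun := fun a => (a ≫ e.hom ≫ biprod.fst, a ≫ e.hom ≫ biprod.snd)
        invFun := fun p => biprod.lift p.1 p.2 ≫ e.inv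
        left_inv := ?_
        right_inv := ?_ }
    · intro a
      rw [← cancel_mono e.hom]
      apply biprod.hom_ext <;> simp
    · rintro ⟨a, b⟩
      simp
  have h2 : Nat.card G.ker ≤ Nat.card (X ⟶ Y) := by
    have hk : ∀ a : G.ker, ∃ b : X ⟶ Y, a.1 = b ≫ f := fun a =>
      Triangle.coyoneda_exact₂ _ ht a.1 a.2
    choose b hb using hk
    refine Nat.card_le_card_of_injective b ?_
    intro a a' haa
    apply Subtype.ext
    rw [hb a, hb a', haa]
  have h3 := G.ker.card_mul_index
  rw [AddSubgroup.index_ker, h1] at h3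
  have hpos : 0 < Nat.card (X ⟶ Y) := Nat.card_pos
  have h4 : Nat.card (X ⟶ X) ≤ Nat.card G.range := by
    have := Nat.mul_le_mul_right (Nat.card G.range) h2
    rw [h3, mul_comm] at this
    exact Nat.le_of_mul_le_mul_left this hpos
  have h5 : G.range = ⊤ := AddSubgroup.eq_top_of_le_card _ h4
  have h6 : 𝟙 X ∈ G.range := by rw [h5]; trivial
  obtain ⟨s, hs⟩ := h6
  have h7 : g ≫ h = 0 := comp_distTriang_mor_zero₂₃ _ ht
  rw [← Category.id_comp h, ← hs, hG, Category.assoc, h7, comp_zero]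

end HallTri
end

section
/- Let k be a finite field with q elements and let C be a skeletally small, idempotent-complete, k-linear triangulated category with shift functor T in which all Hom-spaces are finite. Let Z be an indecomposable object and let L, M be objects with L ≇ M ⊕ TZ. Then for every distinguished triangle t ∈ W_{LZ}^M, the stabilizer of t under the action of Aut(Z) × Aut(L) has cardinality a power of q (in particular its order is congruent to 1 modulo q − 1). -/
open CategoryTheory CategoryTheory.Limits CategoryTheory.Pretriangulated

universe v u

namespace HallTri

variable {k : Type} [Field k] [Fintype k]
variable {C : Type u} [Category.{v} C] [HasZeroObject C] [HasShift C ℤ] [Preadditive C]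
  [∀ n : ℤ, (shiftFunctor C n).Additive] [Pretriangulated C] [IsTriangulated C]
  [Linear k C] [IsIdempotentComplete C] [HasBinaryBiproducts C]

/-- `WT X Y L` : the set of distinguished triangles `Y → L → X → TY`. -/
def WT (X Y L : C) : Type v :=
  {t : (Y ⟶ L) × (L ⟶ X) × (X ⟶ Y⟦(1 : ℤ)⟧) //
    Triangle.mk t.1 t.2.1 t.2.2 ∈ distTriang C}

/-- Orbit relation for the action of `Aut X × Aut Y` on `WT X Y L`:
`(ξ, η) • (f, g, h) = (f∘η⁻¹, ξ∘g, (Tη)∘h∘ξ⁻¹)`. -/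
def WTRel (X Y L : C) (p q : WT X Y L) : Prop :=
  ∃ (ξ : Aut X) (η : Aut Y),
    q.1.1 = η.inv ≫ p.1.1 ∧
    q.1.2.1 = p.1.2.1 ≫ ξ.hom ∧
    q.1.2.2 = ξ.inv ≫ p.1.2.2 ≫ (shiftFunctor C (1 : ℤ)).map η.hom

/-- The triangulated Hall number `F_{XY}^L`, the number of orbits of `Aut X × Aut Y`
on `WT X Y L`. -/
noncomputable def FT (X Y L : C) : ℕ :=
  Nat.card (Quot (WTRel X Y L))

theorem exists_pow_idem {R : Type*} [Monoid R] [Finite R] (a : R) :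
    ∃ n : ℕ, 0 < n ∧ a ^ n * a ^ n = a ^ n := by
  obtain ⟨i, j, hij, h⟩ := Finite.exists_ne_map_eq_of_infinite (fun n : ℕ => a ^ n)
  wlog hlt : i < j generalizing i j
  · exact this j i hij.symm h.symm (by omega)
  obtain ⟨p, rfl⟩ := Nat.exists_eq_add_of_lt hlt
  have key : ∀ t d : ℕ, a ^ (i + d + t * (p + 1)) = a ^ (i + d) := by
    intro t d
    induction t with
    | zero => simp
    | succ t ih =>
      calc a ^ (i + d + (t + 1) * (p + 1)) = a ^ (i + p + 1) * a ^ (d + t * (p + 1)) := by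
            rw [← pow_add]; congr 1; ring
        _ = a ^ (i + d + t * (p + 1)) := by rw [← h, ← pow_add]; congr 1; ring
        _ = _ := ih
  refine ⟨(i + 1) * (p + 1), by positivity, ?_⟩
  have := key (i + 1) (i * p + p + 1)
  rw [← pow_add]
  have e : (i + 1) * (p + 1) = i + (i * p + p + 1) := by ring
  rw [← e] at this
  exact this

theorem idem_trivial {C : Type u} [Category.{v} C] [Preadditive C]
    [IsIdempotentComplete C] [HasBinaryBiproducts C] (Z : C) (hZ : Indecomposable Z)
    (p : Z ⟶ Z) (hp : p ≫ p = p) : p = 0 ∨ p = 𝟙 Z := by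
  obtain ⟨Y, i, e, h1, h2⟩ := IsIdempotentComplete.idempotents_split Z p hp
  obtain ⟨Y', i', e', h1', h2'⟩ :=
    IsIdempotentComplete.idempotents_split Z (𝟙 Z - p) (by simp [hp])
  have hie : i ≫ e' = 0 := by
    calc i ≫ e' = (i ≫ e) ≫ i ≫ e' ≫ (i' ≫ e') := by rw [h1, h1']; simp
      _ = i ≫ (e ≫ i) ≫ (e' ≫ i') ≫ e' := by simp only [Category.assoc]
      _ = 0 := by
        rw [h2, h2', ← Category.assoc p]; simp [hp]
  have hie' : i' ≫ e = 0 := by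
    calc i' ≫ e = (i' ≫ e') ≫ i' ≫ e ≫ (i ≫ e) := by rw [h1, h1']; simp
      _ = i' ≫ (e' ≫ i') ≫ (e ≫ i) ≫ e := by simp only [Category.assoc]
      _ = 0 := by
        rw [h2, h2', ← Category.assoc _ p]; simp [hp]
  let iso : Z ≅ Y ⊞ Y' :=
    { hom := biprod.lift e e'
      inv := biprod.desc i i'
      hom_inv_id := by rw [biprod.lift_desc, h2, h2']; abel
      inv_hom_id := by
        apply biprod.hom_ext' <;> apply biprod.hom_ext <;> simp [h1, h1', hie, hie'] }
  rcases hZ.2 _ _ iso with h | h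
  · left
    rw [← h2, h.eq_of_src i 0, comp_zero]
  · right
    have : 𝟙 Z - p = 0 := by rw [← h2', h.eq_of_src i' 0, comp_zero]
    exact (sub_eq_zero.1 this).symm

/-- an endomorphism of an indecomposable object killed by a nonzero map is nilpotent,
so `1 + a` is invertible -/
theorem isIso_one_add {C : Type u} [Category.{v} C] [Preadditive C]
    [IsIdempotentComplete C] [HasBinaryBiproducts C] (Z M : C) (hZ : Indecomposable Z)
    [Finite (Z ⟶ Z)] (f : Z ⟶ M) (hf : f ≠ 0) (a : Z ⟶ Z) (ha : a ≫ f = 0) :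
    IsIso (𝟙 Z + a) := by
  let x : End Z := a
  have : Finite (End Z) := inferInstanceAs (Finite (Z ⟶ Z))
  obtain ⟨n, hn, hx⟩ := exists_pow_idem x
  have hz : x ^ n = 0 := by
    rcases idem_trivial Z hZ (x ^ n : End Z) hx with h | h
    · exact h
    · exfalso
      apply hf
      obtain ⟨m, rfl⟩ := Nat.exists_eq_succ_of_ne_zero hn.ne'
      have h' : (x ^ m : End Z) ≫ a = 𝟙 Z := by
        rw [← h, pow_succ']; rfl
      rw [← Category.id_comp f, ← h', Category.assoc, ha, comp_zero]
  have hu : IsUnit (1 + x) := IsNilpotent.isUnit_one_add ⟨n, hz⟩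
  exact (isUnit_iff_isIso (1 + x : End Z)).1 hu

theorem card_submodule {k : Type} [Field k] [Fintype k] {V : Type*} [AddCommGroup V]
    [Module k V] [Finite V] : ∃ r : ℕ, Nat.card V = Fintype.card k ^ r := by
  have := Fintype.ofFinite V
  exact ⟨_, by rw [Nat.card_eq_fintype_card]; exact Module.card_eq_pow_finrank (K := k)⟩

/-- Lemma 1(1) (stabilizer part): if `Z` is indecomposable and `L ≇ M ⊞ TZ`, then the
stabilizer of any triangle `t ∈ W_{LZ}^M` under `Aut Z × Aut L` has `q`-power order. -/
theorem stabilizer_card_pow (hHom : ∀ A B : C, Finite (A ⟶ B))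
    (Z L M : C) (hZ : Indecomposable Z)
    (hL : ¬ Nonempty (L ≅ M ⊞ (Z⟦(1 : ℤ)⟧)))
    (t : WT L Z M) :
    ∃ r : ℕ,
      Nat.card {a : Aut Z × Aut L //
        a.1.inv ≫ t.1.1 = t.1.1 ∧
        t.1.2.1 ≫ a.2.hom = t.1.2.1 ∧
        a.2.inv ≫ t.1.2.2 ≫ (shiftFunctor C (1 : ℤ)).map a.1.hom = t.1.2.2} =
      Fintype.card k ^ r := by
  obtain ⟨⟨f, g, h⟩, ht⟩ := t
  dsimp only at ht ⊢
  have hf : f ≠ 0 := by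
    intro hf
    apply hL
    obtain ⟨e, -⟩ := exists_iso_binaryBiproduct_of_distTriang _ (rot_of_distTriang _ ht)
      (by
        subst hf
        change -(shiftFunctor C (1 : ℤ)).map (0 : Z ⟶ M) = 0
        rw [Functor.map_zero, neg_zero])
    exact ⟨e⟩
  have := hHom Z Z
  have := hHom L L
  let A : Submodule k (Z ⟶ Z) := LinearMap.ker (Linear.rightComp k Z f)
  let B : Submodule k (L ⟶ L) :=
    LinearMap.ker (Linear.leftComp k L g) ⊓ LinearMap.ker (Linear.rightComp k L h)
  have hA : ∀ a, a ∈ A ↔ a ≫ f = 0 := fun a => by simp [A]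
  have hB : ∀ b, b ∈ B ↔ g ≫ b = 0 ∧ b ≫ h = 0 := fun b => by simp [B]
  have hc : ∀ a : A, ∃ c : L ⟶ L, g ≫ c = 0 ∧
      h ≫ (shiftFunctor C (1 : ℤ)).map a.1 = c ≫ h := by
    intro a
    obtain ⟨c, h1, h2⟩ := complete_distinguished_triangle_morphism _ _ ht ht a.1 0
      (comp_zero.trans ((hA _).1 a.2).symm)
    exact ⟨c, h1.trans zero_comp, h2⟩
  choose c hc1 hc2 using hc
  have iso1 : ∀ a : A, IsIso (𝟙 Z + a.1) := fun a =>
    isIso_one_add Z M hZ f hf a.1 ((hA _).1 a.2)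
  have iso2 : ∀ (a : A) (b : B), IsIso (𝟙 L + c a + b.1) := by
    intro a b
    obtain ⟨hb1, hb2⟩ := (hB _).1 b.2
    have e1 : f ≫ 𝟙 M = (𝟙 Z + a.1) ≫ f := by simp [(hA _).1 a.2]
    have e2 : g ≫ (𝟙 L + c a + b.1) = 𝟙 M ≫ g := by simp [hc1, hb1]
    have e3 : h ≫ (shiftFunctor C (1 : ℤ)).map (𝟙 Z + a.1) = (𝟙 L + c a + b.1) ≫ h := by
      simp [hc2, hb2, Functor.map_add]
    let φ : Triangle.mk f g h ⟶ Triangle.mk f g h :=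
      { hom₁ := 𝟙 Z + a.1
        hom₂ := 𝟙 M
        hom₃ := 𝟙 L + c a + b.1
        comm₁ := e1
        comm₂ := e2
        comm₃ := e3 }
    exact isIso₃_of_isIso₁₂ φ ht ht (iso1 a) (inferInstanceAs (IsIso (𝟙 M)))
  let F : A × B → {a : Aut Z × Aut L // a.1.inv ≫ f = f ∧ g ≫ a.2.hom = g ∧
        a.2.inv ≫ h ≫ (shiftFunctor C (1 : ℤ)).map a.1.hom = h} := fun x =>
    ⟨(@asIso _ _ _ _ (𝟙 Z + x.1.1) (iso1 x.1),
      @asIso _ _ _ _ (𝟙 L + c x.1 + x.2.1) (iso2 x.1 x.2)), by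
      obtain ⟨hb1, hb2⟩ := (hB _).1 x.2.2
      have := iso1 x.1
      have := iso2 x.1 x.2
      refine ⟨?_, ?_, ?_⟩
      · rw [Iso.inv_comp_eq]
        simp [(hA _).1 x.1.2]
      · simp [hc1, hb1]
      · rw [Iso.inv_comp_eq]
        simp [hc2, hb2, Functor.map_add]⟩
  have hF : Function.Bijective F := by
    constructor
    · rintro ⟨a, b⟩ ⟨a', b'⟩ hab
      have h1 : 𝟙 Z + a.1 = 𝟙 Z + a'.1 := congrArg (fun x => x.1.1.hom) hab
      have h2 : 𝟙 L + c a + b.1 = 𝟙 L + c a' + b'.1 := congrArg (fun x => x.1.2.hom) hab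
      have ha : a = a' := Subtype.ext (add_left_cancel h1)
      subst ha
      have hb : b = b' := Subtype.ext (add_left_cancel h2)
      subst hb
      rfl
    · rintro ⟨⟨η, ξ⟩, h1, h2, h3⟩
      dsimp only at h1 h2 h3
      replace h1 : f = η.hom ≫ f := (Iso.inv_comp_eq (X := Z) (Y := Z) η).1 h1
      replace h3 : h ≫ (shiftFunctor C (1 : ℤ)).map η.hom = ξ.hom ≫ h :=
        (Iso.inv_comp_eq (X := L) (Y := L) ξ).1 h3
      let a : A := ⟨η.hom - 𝟙 Z, (hA _).2 (by rw [Preadditive.sub_comp, ← h1]; simp)⟩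
      have hca := hc2 a
      let b : B := ⟨ξ.hom - 𝟙 L - c a, (hB _).2 ⟨by
        rw [Preadditive.comp_sub, Preadditive.comp_sub, h2, hc1]; simp, by
        rw [Preadditive.sub_comp, Preadditive.sub_comp, ← h3, ← hca]
        simp [a, Functor.map_sub]⟩⟩
      refine ⟨(a, b), Subtype.ext (Prod.ext (Iso.ext ?_) (Iso.ext ?_))⟩
      · change 𝟙 Z + (η.hom - 𝟙 Z) = η.hom
        abel
      · change 𝟙 L + c a + (ξ.hom - 𝟙 L - c a) = ξ.hom
        abel
  obtain ⟨r, hr⟩ := card_submodule (k := k) (V := A)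
  obtain ⟨s, hs⟩ := card_submodule (k := k) (V := B)
  refine ⟨r + s, ?_⟩
  rw [← Nat.card_eq_of_bijective F hF, Nat.card_prod, hr, hs, pow_add]


end HallTri
end

section
/- Let k be a finite field and let C be a skeletally small, idempotent-complete, k-linear triangulated category with shift functor T in which all Hom-spaces are finite. Let Z be an indecomposable object, M any object, and set L := M ⊕ TZ. Then the group Aut(Z) × Aut(L) acts transitively on W_{LZ}^M (i.e. F_{LZ}^M = 1), and |W_{LZ}^M| · |Hom(TZ, M)| = |Aut(L)|. -/
open CategoryTheory CategoryTheory.Limits CategoryTheory.Pretriangulated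

universe v u

namespace HallTri

variable {k : Type} [Field k] [Fintype k]
variable {C : Type u} [Category.{v} C] [HasZeroObject C] [HasShift C ℤ] [Preadditive C]
  [∀ n : ℤ, (shiftFunctor C n).Additive] [Pretriangulated C] [IsTriangulated C]
  [Linear k C] [IsIdempotentComplete C] [HasBinaryBiproducts C]

section Helpers

variable (Z M : C)

/-- Counting homs shows that the first map of such a triangle vanishes. -/
theorem first_zero (hHom : ∀ A B : C, Finite (A ⟶ B))
    (p : WT (M ⊞ (Z⟦(1 : ℤ)⟧)) Z M) : p.1.1 = 0 := by
  obtain ⟨⟨f, g, h⟩, hp⟩ := p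
  change f = 0
  have hp' : Triangle.mk f g h ∈ distTriang C := hp
  have hfg : f ≫ g = 0 := comp_distTriang_mor_zero₁₂ _ hp'
  have := hHom Z M
  have := hHom Z (Z⟦(1 : ℤ)⟧)
  have := hHom Z (M ⊞ (Z⟦(1 : ℤ)⟧))
  let G := Preadditive.rightComp Z g
  let H := Preadditive.rightComp Z h
  have e : Nat.card (Z ⟶ M ⊞ (Z⟦(1 : ℤ)⟧)) =
      Nat.card (Z ⟶ M) * Nat.card (Z ⟶ Z⟦(1 : ℤ)⟧) := by
    rw [← Nat.card_prod]
    exact Nat.card_congr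
      { toFun := fun a => (a ≫ biprod.fst, a ≫ biprod.snd)
        invFun := fun a => biprod.lift a.1 a.2
        left_inv := fun a => by apply biprod.hom_ext <;> simp
        right_inv := fun a => by simp }
  have h1 : Nat.card H.ker * Nat.card H.range = Nat.card (Z ⟶ M ⊞ (Z⟦(1 : ℤ)⟧)) := by
    rw [← AddSubgroup.index_ker, AddSubgroup.card_mul_index]
  have h2 : Nat.card H.range ≤ Nat.card (Z ⟶ Z⟦(1 : ℤ)⟧) :=
    Nat.card_le_card_of_injective _ Subtype.val_injective
  have h3 : Nat.card (Z ⟶ M) ≤ Nat.card H.ker := by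
    have hpos : 0 < Nat.card (Z ⟶ Z⟦(1 : ℤ)⟧) := Nat.card_pos
    refine Nat.le_of_mul_le_mul_right ?_ hpos
    rw [← e, ← h1]
    exact Nat.mul_le_mul_left _ h2
  have h4 : H.ker ≤ G.range := by
    intro a ha
    obtain ⟨b, hb⟩ := Triangle.coyoneda_exact₃ _ hp' a ha
    exact ⟨b, hb.symm⟩
  have h5 : Nat.card H.ker ≤ Nat.card G.range :=
    Nat.card_le_card_of_injective _ (AddSubgroup.inclusion_injective h4)
  have h6 := (G.rangeRestrict_surjective).bijective_of_nat_card_le (h3.trans h5)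
  apply h6.1
  apply Subtype.ext
  change f ≫ g = (0 : Z ⟶ M) ≫ g
  rw [hfg, zero_comp]

/-- A triangle with vanishing first map is split. -/
theorem exists_split (hHom : ∀ A B : C, Finite (A ⟶ B))
    (p : WT (M ⊞ (Z⟦(1 : ℤ)⟧)) Z M) :
    ∃ e : (M ⊞ (Z⟦(1 : ℤ)⟧)) ≅ (M ⊞ (Z⟦(1 : ℤ)⟧)),
      p.1.2.1 = biprod.inl ≫ e.hom ∧ p.1.2.2 = e.inv ≫ biprod.snd := by
  have h0 := first_zero Z M hHom p
  obtain ⟨⟨f, g, h⟩, hp⟩ := p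
  obtain rfl : f = 0 := h0
  have hr := rot_of_distTriang _ hp
  obtain ⟨e, he1, he2⟩ := exists_iso_binaryBiproduct_of_distTriang _ hr (by
    change -(shiftFunctor C (1 : ℤ)).map (0 : Z ⟶ M) = 0
    rw [Functor.map_zero, neg_zero])
  refine ⟨e.symm, ?_, ?_⟩
  · exact (Iso.eq_comp_inv e).2 he1
  · exact he2

theorem ofAut_mem (e : (M ⊞ (Z⟦(1 : ℤ)⟧)) ≅ (M ⊞ (Z⟦(1 : ℤ)⟧))) :
    Triangle.mk (0 : Z ⟶ M) (biprod.inl ≫ e.hom) (e.inv ≫ biprod.snd) ∈ distTriang C := by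
  rw [rotate_distinguished_triangle]
  refine isomorphic_distinguished _ (binaryBiproductTriangle_distinguished M (Z⟦(1 : ℤ)⟧)) _ ?_
  refine Triangle.isoMk _ _ (Iso.refl M) e.symm (Iso.refl (Z⟦(1 : ℤ)⟧)) ?_ ?_ ?_
  · change (biprod.inl ≫ e.hom) ≫ e.inv = 𝟙 M ≫ biprod.inl
    rw [Category.assoc, e.hom_inv_id, Category.comp_id, Category.id_comp]
  · change (e.inv ≫ biprod.snd) ≫ 𝟙 (Z⟦(1 : ℤ)⟧) = e.inv ≫ biprod.snd
    rw [Category.comp_id]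
  · change (-(shiftFunctor C (1 : ℤ)).map (0 : Z ⟶ M)) ≫ (shiftFunctor C (1 : ℤ)).map (𝟙 M) =
      𝟙 (Z⟦(1 : ℤ)⟧) ≫ 0
    rw [Functor.map_zero, neg_zero, zero_comp, comp_zero]

/-- Every automorphism of the biproduct gives a distinguished triangle. -/
noncomputable def ofAut (e : (M ⊞ (Z⟦(1 : ℤ)⟧)) ≅ (M ⊞ (Z⟦(1 : ℤ)⟧))) :
    WT (M ⊞ (Z⟦(1 : ℤ)⟧)) Z M :=
  ⟨(0, biprod.inl ≫ e.hom, e.inv ≫ biprod.snd), ofAut_mem Z M e⟩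

/-- The unipotent automorphism attached to `u : TZ ⟶ M`. -/
@[simps]
noncomputable def unip {M N : C} (u : N ⟶ M) : (M ⊞ N) ≅ (M ⊞ N) where
  hom := 𝟙 _ + biprod.snd ≫ u ≫ biprod.inl
  inv := 𝟙 _ - biprod.snd ≫ u ≫ biprod.inl
  hom_inv_id := by simp
  inv_hom_id := by simp

theorem eq_unip {M N : C} (a : (M ⊞ N) ⟶ (M ⊞ N)) (h1 : biprod.inl ≫ a = biprod.inl)
    (h2 : a ≫ biprod.snd = biprod.snd) :
    a = 𝟙 _ + biprod.snd ≫ (biprod.inr ≫ a ≫ biprod.fst) ≫ biprod.inl := by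
  apply biprod.hom_ext <;> apply biprod.hom_ext' <;> simp [h2, reassoc_of% h1]

theorem card_aut (hHom : ∀ A B : C, Finite (A ⟶ B)) :
    Nat.card (WT (M ⊞ (Z⟦(1 : ℤ)⟧)) Z M) * Nat.card ((Z⟦(1 : ℤ)⟧ : C) ⟶ M) =
      Nat.card (Aut (M ⊞ (Z⟦(1 : ℤ)⟧))) := by
  choose φ hφ1 hφ2 using exists_split Z M hHom
  rw [← Nat.card_prod]
  refine Nat.card_eq_of_bijective
    (fun x => (unip x.2 ≪≫ φ x.1 : (M ⊞ (Z⟦(1 : ℤ)⟧)) ≅ (M ⊞ (Z⟦(1 : ℤ)⟧)))) ⟨?_, ?_⟩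
  · rintro ⟨p, u⟩ ⟨q, w⟩ hpq
    have hpq : unip u ≪≫ φ p = unip w ≪≫ φ q := hpq
    have hh := congrArg Iso.hom hpq
    have hi := congrArg Iso.inv hpq
    have hp : p = q := by
      apply Subtype.ext
      refine Prod.ext ?_ (Prod.ext ?_ ?_)
      · rw [first_zero Z M hHom p, first_zero Z M hHom q]
      · rw [hφ1, hφ1]
        have := congrArg (fun t => biprod.inl ≫ t) hh
        simpa using this
      · rw [hφ2, hφ2]
        have := congrArg (fun t => t ≫ biprod.snd) hi
        simpa using this
    subst hp
    have h3 : (unip u).hom = (unip w).hom := (cancel_mono (φ p).hom).1 hh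
    have h4 := congrArg (fun t => biprod.inr ≫ t ≫ biprod.fst) h3
    have : u = w := by simpa using h4
    rw [this]
  · intro e
    let e' : (M ⊞ (Z⟦(1 : ℤ)⟧)) ≅ (M ⊞ (Z⟦(1 : ℤ)⟧)) := e
    let p := ofAut Z M e'
    have h1 : biprod.inl ≫ e'.hom = biprod.inl ≫ (φ p).hom := hφ1 p
    have h2 : e'.inv ≫ biprod.snd = (φ p).inv ≫ biprod.snd := hφ2 p
    have h := eq_unip (e'.hom ≫ (φ p).inv) (by rw [reassoc_of% h1]; simp)
      (by rw [Category.assoc, ← h2]; simp)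
    refine ⟨(p, biprod.inr ≫ (e'.hom ≫ (φ p).inv) ≫ biprod.fst), ?_⟩
    apply Iso.ext
    change (_ + _) ≫ (φ p).hom = e'.hom
    rw [← h]
    simp

end Helpers

/-- Lemma 1(2): for `Z` indecomposable and `L = M ⊞ TZ`, the action of `Aut Z × Aut L`
on `W_{LZ}^M` is transitive, i.e. `F_{LZ}^M = 1`, and
`|W_{LZ}^M| ⬝ |Hom(TZ, M)| = |Aut L|`. -/
theorem split_orbit_count (hHom : ∀ A B : C, Finite (A ⟶ B))
    (Z M : C) (hZ : Indecomposable Z) :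
    (∀ p q : WT (M ⊞ (Z⟦(1 : ℤ)⟧)) Z M, WTRel (M ⊞ (Z⟦(1 : ℤ)⟧)) Z M p q) ∧
    FT (M ⊞ (Z⟦(1 : ℤ)⟧)) Z M = 1 ∧
    Nat.card (WT (M ⊞ (Z⟦(1 : ℤ)⟧)) Z M) * Nat.card ((Z⟦(1 : ℤ)⟧ : C) ⟶ M) =
      Nat.card (Aut (M ⊞ (Z⟦(1 : ℤ)⟧))) := by
  have trans : ∀ p q : WT (M ⊞ (Z⟦(1 : ℤ)⟧)) Z M, WTRel (M ⊞ (Z⟦(1 : ℤ)⟧)) Z M p q := by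
    intro p q
    obtain ⟨a, ha1, ha2⟩ := exists_split Z M hHom p
    obtain ⟨b, hb1, hb2⟩ := exists_split Z M hHom q
    refine ⟨a.symm ≪≫ b, Iso.refl _, ?_, ?_, ?_⟩
    · rw [first_zero Z M hHom p, first_zero Z M hHom q, comp_zero]
    · rw [ha1, hb1]; simp
    · rw [ha2, hb2]; simp
  refine ⟨trans, ?_, card_aut Z M hHom⟩
  have : Subsingleton (Quot (WTRel (M ⊞ (Z⟦(1 : ℤ)⟧)) Z M)) := ⟨by
    rintro ⟨p⟩ ⟨q⟩
    exact Quot.sound (trans p q)⟩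
  have : Nonempty (Quot (WTRel (M ⊞ (Z⟦(1 : ℤ)⟧)) Z M)) :=
    ⟨Quot.mk _ (ofAut Z M (Iso.refl _))⟩
  exact Nat.card_unique

end HallTri
end

section
/- Let k be a finite field and let C be a skeletally small, idempotent-complete, k-linear triangulated category with shift functor T in which all Hom-spaces are finite. Let X and Y be indecomposable objects. Then |W_{XY}^{X⊕Y}| · |Hom(X,Y)| = |Aut(X ⊕ Y)|. -/
open CategoryTheory CategoryTheory.Limits CategoryTheory.Pretriangulated

universe v u

namespace HallTri

variable {k : Type} [Field k] [Fintype k]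
variable {C : Type u} [Category.{v} C] [HasZeroObject C] [HasShift C ℤ] [Preadditive C]
  [∀ n : ℤ, (shiftFunctor C n).Additive] [Pretriangulated C] [IsTriangulated C]
  [Linear k C] [IsIdempotentComplete C] [HasBinaryBiproducts C]

/-- In a distinguished triangle `Y → X ⊞ Y → X → TY` the second map is a split epimorphism. -/
theorem exists_section (hHom : ∀ A B : C, Finite (A ⟶ B)) (X Y : C) (w : WT X Y (X ⊞ Y)) :
    ∃ s : X ⟶ X ⊞ Y, s ≫ w.1.2.1 = 𝟙 X := by
  obtain ⟨⟨f, g, h⟩, hw⟩ := w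
  dsimp only at hw ⊢
  have hfg : f ≫ g = 0 := comp_distTriang_mor_zero₁₂ _ hw
  let G : (X ⟶ X ⊞ Y) →+ (X ⟶ X) := Preadditive.rightComp X g
  have := hHom X X
  have := hHom X Y
  have := hHom X (X ⊞ Y)
  have h1 : Nat.card G.ker ≤ Nat.card (X ⟶ Y) := by
    refine Nat.card_le_card_of_surjective
      (fun u : X ⟶ Y => (⟨u ≫ f, by
        change (u ≫ f) ≫ g = 0
        rw [Category.assoc, hfg, comp_zero]⟩ : G.ker)) ?_
    rintro ⟨a, ha⟩
    obtain ⟨b, hb⟩ := Triangle.coyoneda_exact₂ _ hw a ha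
    exact ⟨b, Subtype.ext hb.symm⟩
  have h2 : Nat.card (X ⟶ X ⊞ Y) = Nat.card (X ⟶ X) * Nat.card (X ⟶ Y) := by
    rw [← Nat.card_prod]
    exact Nat.card_congr
      { toFun := fun a => (a ≫ biprod.fst, a ≫ biprod.snd)
        invFun := fun p => biprod.lift p.1 p.2
        left_inv := fun a => by apply biprod.hom_ext <;> simp
        right_inv := fun p => by simp }
  have h3 : Nat.card (X ⟶ X ⊞ Y) = Nat.card G.range * Nat.card G.ker := by
    rw [AddSubgroup.card_eq_card_quotient_mul_card_addSubgroup G.ker]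
    congr 1
    exact Nat.card_congr (QuotientAddGroup.quotientKerEquivRange G).toEquiv
  have hpos : 0 < Nat.card (X ⟶ Y) := Nat.card_pos
  have h4 : Nat.card (X ⟶ X) ≤ Nat.card G.range := by
    refine Nat.le_of_mul_le_mul_right ?_ hpos
    rw [← h2, h3]
    exact Nat.mul_le_mul_left _ h1
  have h5 : G.range = ⊤ := AddSubgroup.eq_top_of_le_card _ h4
  have h6 : 𝟙 X ∈ G.range := by rw [h5]; trivial
  exact h6

/-- The automorphism attached to a triangle and a section. -/
theorem isIso_desc (X Y : C) (f : Y ⟶ X ⊞ Y) (g : X ⊞ Y ⟶ X) (h : X ⟶ Y⟦(1 : ℤ)⟧)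
    (hw : Triangle.mk f g h ∈ distTriang C) (s : X ⟶ X ⊞ Y) (hs : s ≫ g = 𝟙 X) :
    Mono f ∧ ∃ r : X ⊞ Y ⟶ Y, biprod.desc s f ≫ biprod.lift g r = 𝟙 _ ∧
      biprod.lift g r ≫ biprod.desc s f = 𝟙 _ := by
  have hfg : f ≫ g = 0 := comp_distTriang_mor_zero₁₂ _ hw
  have hgh : g ≫ h = 0 := comp_distTriang_mor_zero₂₃ _ hw
  have h0 : h = 0 := by rw [← Category.id_comp h, ← hs, Category.assoc, hgh, comp_zero]
  have hm : Mono f := Triangle.mono₁ _ hw h0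
  obtain ⟨r, hr⟩ : ∃ r : X ⊞ Y ⟶ Y, 𝟙 _ - g ≫ s = r ≫ f :=
    Triangle.coyoneda_exact₂ _ hw (𝟙 _ - g ≫ s)
      (by change (𝟙 _ - g ≫ s) ≫ g = 0; simp [Preadditive.sub_comp, hs])
  have hfr : f ≫ r = 𝟙 Y := by
    rw [← cancel_mono f, Category.assoc, ← hr]
    simp [Preadditive.comp_sub, reassoc_of% hfg]
  have hsr : s ≫ r = 0 := by
    rw [← cancel_mono f, Category.assoc, ← hr]
    simp [Preadditive.comp_sub, reassoc_of% hs]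
  refine ⟨hm, r, ?_, ?_⟩
  · apply biprod.hom_ext <;> apply biprod.hom_ext' <;> simp [hfg, hs, hfr, hsr]
  · rw [biprod.lift_desc, ← hr]
    abel

/-- The triangle attached to an automorphism is distinguished. -/
theorem dist_of_aut (X Y : C) (φ : X ⊞ Y ≅ X ⊞ Y) :
    Triangle.mk (biprod.inr ≫ φ.hom) (φ.inv ≫ biprod.fst) (0 : X ⟶ Y⟦(1 : ℤ)⟧) ∈
      distTriang C := by
  refine isomorphic_distinguished _ (binaryBiproductTriangle_distinguished Y X) _ ?_
  refine (Triangle.isoMk (binaryBiproductTriangle Y X)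
    (Triangle.mk (biprod.inr ≫ φ.hom) (φ.inv ≫ biprod.fst) (0 : X ⟶ Y⟦(1 : ℤ)⟧)) (Iso.refl _) (biprod.braiding Y X ≪≫ φ) (Iso.refl _) ?_ ?_ ?_).symm
  · change (biprod.inl : Y ⟶ Y ⊞ X) ≫ (biprod.braiding Y X).hom ≫ φ.hom =
      𝟙 Y ≫ biprod.inr ≫ φ.hom
    rw [Category.id_comp, ← Category.assoc]
    congr 1
    apply biprod.hom_ext <;> simp
  · change (biprod.snd : Y ⊞ X ⟶ X) ≫ 𝟙 X =
      ((biprod.braiding Y X).hom ≫ φ.hom) ≫ φ.inv ≫ biprod.fst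
    simp
  · change (0 : X ⟶ Y⟦(1 : ℤ)⟧) ≫ (shiftFunctor C (1 : ℤ)).map (𝟙 Y) = 𝟙 X ≫ 0
    simp

/-- Lemma 2(3): for `X` and `Y` indecomposable,
`|W_{XY}^{X ⊞ Y}| ⬝ |Hom(X, Y)| = |Aut (X ⊞ Y)|`. -/
theorem card_W_split (hHom : ∀ A B : C, Finite (A ⟶ B))
    (X Y : C) (hX : Indecomposable X) (hY : Indecomposable Y) :
    Nat.card (WT X Y (X ⊞ Y)) * Nat.card (X ⟶ Y) = Nat.card (Aut (X ⊞ Y)) := by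
  classical
  choose s hs using exists_section hHom X Y
  have hsu : ∀ (w : WT X Y (X ⊞ Y)) (u : X ⟶ Y), (s w + u ≫ w.1.1) ≫ w.1.2.1 = 𝟙 X := by
    intro w u
    have hfg : w.1.1 ≫ w.1.2.1 = 0 := comp_distTriang_mor_zero₁₂ _ w.2
    simp [Preadditive.add_comp, hs, hfg]
  have key := fun (w : WT X Y (X ⊞ Y)) (u : X ⟶ Y) =>
    isIso_desc X Y w.1.1 w.1.2.1 w.1.2.2 w.2 _ (hsu w u)
  choose hm r hr1 hr2 using key
  let Φ : WT X Y (X ⊞ Y) × (X ⟶ Y) → Aut (X ⊞ Y) := fun p =>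
    { hom := biprod.desc (s p.1 + p.2 ≫ p.1.1.1) p.1.1.1
      inv := biprod.lift p.1.1.2.1 (r p.1 p.2)
      hom_inv_id := hr1 _ _
      inv_hom_id := hr2 _ _ }
  have hΦ : Function.Bijective Φ := by
    constructor
    · rintro ⟨w, u⟩ ⟨w', u'⟩ e
      have e1 : biprod.desc (s w + u ≫ w.1.1) w.1.1 =
        biprod.desc (s w' + u' ≫ w'.1.1) w'.1.1 := congrArg Iso.hom e
      have e2 : biprod.lift w.1.2.1 (r w u) = biprod.lift w'.1.2.1 (r w' u') :=
        congrArg Iso.inv e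
      have hf : w.1.1 = w'.1.1 := by simpa using congrArg (biprod.inr ≫ ·) e1
      have hg : w.1.2.1 = w'.1.2.1 := by simpa using congrArg (· ≫ biprod.fst) e2
      have hz : ∀ w : WT X Y (X ⊞ Y), w.1.2.2 = 0 := by
        intro w
        have hgh : w.1.2.1 ≫ w.1.2.2 = 0 := comp_distTriang_mor_zero₂₃ _ w.2
        rw [← Category.id_comp w.1.2.2, ← hs w, Category.assoc, hgh, comp_zero]
      have hww : w = w' :=
        Subtype.ext (Prod.ext hf (Prod.ext hg ((hz w).trans (hz w').symm)))
      subst hww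
      have hu : s w + u ≫ w.1.1 = s w + u' ≫ w.1.1 := by
        simpa using congrArg (biprod.inl ≫ ·) e1
      have := hm w u
      rw [Prod.mk.injEq]
      exact ⟨rfl, (cancel_mono w.1.1).1 (add_left_cancel hu)⟩
    · intro (φ : X ⊞ Y ≅ X ⊞ Y)
      let w : WT X Y (X ⊞ Y) :=
        ⟨(biprod.inr ≫ φ.hom, φ.inv ≫ biprod.fst, 0), dist_of_aut X Y φ⟩
      obtain ⟨u, hu⟩ : ∃ u : X ⟶ Y, biprod.inl ≫ φ.hom - s w = u ≫ w.1.1 :=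
        Triangle.coyoneda_exact₂ _ w.2 (biprod.inl ≫ φ.hom - s w) (by
          change (biprod.inl ≫ φ.hom - s w) ≫ w.1.2.1 = 0
          rw [Preadditive.sub_comp, hs]
          simp [w])
      refine ⟨(w, u), Iso.ext ?_⟩
      change biprod.desc (s w + u ≫ w.1.1) w.1.1 = φ.hom
      rw [← hu]
      apply biprod.hom_ext' <;> simp [w]
  rw [← Nat.card_prod]
  exact Nat.card_congr (Equiv.ofBijective Φ hΦ)

end HallTri
end

section
/- Let k be a finite field with q elements and let C be a skeletally small, idempotent-complete, k-linear triangulated category with shift functor T in which all Hom-spaces are finite. Let X, Y, Z be indecomposable objects and let L, M be objects with L ≇ 0 and L ≇ M ⊕ TZ. Then for every pair (t,u) ∈ W_{XY}^L × W_{LZ}^M, the stabilizer of (t,u) under the action of Aut(X,Y,Z,L) has cardinality a power of q. -/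
open CategoryTheory CategoryTheory.Limits CategoryTheory.Pretriangulated

universe v u

namespace HallTri

variable {k : Type} [Field k] [Fintype k]
variable {C : Type u} [Category.{v} C] [HasZeroObject C] [HasShift C ℤ] [Preadditive C]
  [∀ n : ℤ, (shiftFunctor C n).Additive] [Pretriangulated C] [IsTriangulated C]
  [Linear k C] [IsIdempotentComplete C] [HasBinaryBiproducts C]

/-- The statement that `(ξ,η,ζ,λ) = (a.1, a.2.1, a.2.2.1, a.2.2.2)` fixes the pair
`(t, u) ∈ W_{XY}^L × W_{LZ}^M` under the `Aut(X,Y,Z,L)`-action sending `((f,g,h),(l,m,n))`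
to `((λ∘f∘η⁻¹, ξ∘g∘λ⁻¹, (Tη)∘h∘ξ⁻¹), (l∘ζ⁻¹, λ∘m, (Tζ)∘n∘λ⁻¹))`. -/
def FixesPair {X Y Z L M : C} (a : Aut X × Aut Y × Aut Z × Aut L)
    (t : WT X Y L) (u : WT L Z M) : Prop :=
  a.2.1.inv ≫ t.1.1 ≫ a.2.2.2.hom = t.1.1 ∧
  a.2.2.2.inv ≫ t.1.2.1 ≫ a.1.hom = t.1.2.1 ∧
  a.1.inv ≫ t.1.2.2 ≫ (shiftFunctor C (1 : ℤ)).map a.2.1.hom = t.1.2.2 ∧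
  a.2.2.1.inv ≫ u.1.1 = u.1.1 ∧
  u.1.2.1 ≫ a.2.2.2.hom = u.1.2.1 ∧
  a.2.2.2.inv ≫ u.1.2.2 ≫ (shiftFunctor C (1 : ℤ)).map a.2.2.1.hom = u.1.2.2

/-! ### Finite rings in which every element is nilpotent or a unit -/

set_option linter.unusedSectionVars false

lemma nilp_or_unit_of_idem {R : Type*} [Ring R] [Finite R]
    (hid : ∀ e : R, e * e = e → e = 0 ∨ e = 1) (x : R) : IsNilpotent x ∨ IsUnit x := by
  obtain ⟨a, b, hab, hx⟩ : ∃ a b : ℕ, a < b ∧ x ^ a = x ^ b := by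
    obtain ⟨a, b, hne, h⟩ := Finite.exists_ne_map_eq_of_infinite (fun n : ℕ => x ^ n)
    rcases lt_or_gt_of_ne hne with h' | h'
    · exact ⟨a, b, h', h⟩
    · exact ⟨b, a, h', h.symm⟩
  obtain ⟨d, rfl⟩ := Nat.exists_eq_add_of_lt hab
  have key : ∀ j m : ℕ, a ≤ m → x ^ (m + j * (d + 1)) = x ^ m := by
    intro j
    induction j with
    | zero => intro m _; simp
    | succ j ih =>
      intro m hm
      have h1 : m + (j + 1) * (d + 1) = (m + (d + 1)) + j * (d + 1) := by ring
      rw [h1, ih _ (by omega)]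
      obtain ⟨c, rfl⟩ := Nat.exists_eq_add_of_le hm
      have h2 : a + c + (d + 1) = (a + d + 1) + c := by ring
      rw [h2, pow_add, ← hx, ← pow_add]
  have hn : a ≤ (a + 1) * (d + 1) := by nlinarith [Nat.zero_le (a * d)]
  have hidem : x ^ ((a + 1) * (d + 1)) * x ^ ((a + 1) * (d + 1)) = x ^ ((a + 1) * (d + 1)) := by
    rw [← pow_add]
    exact key _ _ hn
  rcases hid _ hidem with h | h
  · exact Or.inl ⟨_, h⟩
  · right
    exact IsUnit.of_pow_eq_one h (by positivity)

lemma nilp_sum {R : Type*} [Ring R] (hR : ∀ x : R, IsNilpotent x ∨ IsUnit x)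
    (a b : R) (ha : IsNilpotent a) (hb : IsNilpotent b) (h0 : (1 : R) ≠ 0) :
    IsNilpotent (a + b) := by
  have : Nontrivial R := ⟨1, 0, h0⟩
  rcases hR (a + b) with h | ⟨u, hu⟩
  · exact h
  · exfalso
    have hna : ¬ IsUnit (↑u⁻¹ * a) := by
      intro h
      have : IsUnit a := by
        have := u.isUnit.mul h
        simpa using this
      exact ha.not_isUnit this
    have hnb : ¬ IsUnit (↑u⁻¹ * b) := by
      intro h
      have : IsUnit b := by
        have := u.isUnit.mul h
        simpa using this
      exact hb.not_isUnit this
    have hs : (↑u⁻¹ * a : R) + ↑u⁻¹ * b = 1 := by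
      rw [← mul_add, ← hu, Units.inv_mul]
    have : IsUnit (1 - (↑u⁻¹ * b : R)) := ((hR _).resolve_right hnb).isUnit_one_sub
    rw [← hs, add_sub_cancel_right] at this
    exact hna this

lemma eq_of_frob {R : Type*} [Ring R] (p n : ℕ) [ExpChar R p]
    (x y : R) (hc : Commute x y) (hp : 1 < p ^ n) (hx : x ^ (p ^ n) = x) (hy : y ^ (p ^ n) = y)
    (hn : IsNilpotent (x - y)) : x = y := by
  have h1 : (x - y) ^ (p ^ n) = x - y := by
    rw [sub_pow_expChar_pow_of_commute _ _ hc, hx, hy]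
  have h2 : (x - y) * (1 - (x - y) ^ (p ^ n - 1)) = 0 := by
    rw [mul_sub, mul_one, ← pow_succ', Nat.sub_add_cancel hp.le, h1, sub_self]
  have h3 : IsUnit (1 - (x - y) ^ (p ^ n - 1)) :=
    (hn.pow_of_pos (by omega)).isUnit_one_sub
  exact sub_eq_zero.1 ((h3.mul_left_eq_zero).1 h2)

/-! ### Local endomorphism rings -/

/-- Nilpotency of an endomorphism. -/
abbrev NilE {X : C} (x : X ⟶ X) : Prop := IsNilpotent (R := End X) x

lemma idem_of_indec {X : C} (hX : Indecomposable X) (e : X ⟶ X) (he : e ≫ e = e) :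
    e = 0 ∨ e = 𝟙 X := by
  obtain ⟨A, i, r, hir, hri⟩ := IsIdempotentComplete.idempotents_split X e he
  obtain ⟨B, g, h, hT⟩ := distinguished_cocone_triangle i
  have hz : h = 0 := by
    have h31 : h ≫ i⟦(1 : ℤ)⟧' = 0 := comp_distTriang_mor_zero₃₁ _ hT
    have h2 : i⟦(1 : ℤ)⟧' ≫ r⟦(1 : ℤ)⟧' = 𝟙 _ := by
      rw [← Functor.map_comp, hir, CategoryTheory.Functor.map_id]
    calc h = h ≫ i⟦(1 : ℤ)⟧' ≫ r⟦(1 : ℤ)⟧' := by rw [h2, Category.comp_id]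
      _ = 0 := by rw [← Category.assoc, h31, zero_comp]
  obtain ⟨e', _⟩ := exists_iso_binaryBiproduct_of_distTriang _ hT hz
  rcases hX.2 _ _ e' with h0 | h0
  · left
    have h0' : IsZero A := h0
    rw [← hri, h0'.eq_of_src i 0, comp_zero]
  · right
    have h0' : IsZero B := h0
    have hg : 𝟙 X - e = 0 := by
      have hie : i ≫ (𝟙 X - e) = 0 := by
        rw [Preadditive.comp_sub, ← hri, ← Category.assoc, hir]; simp
      obtain ⟨w, hw⟩ := Triangle.yoneda_exact₂ _ hT (𝟙 X - e) hie
      rw [hw, h0'.eq_of_src w 0]; exact comp_zero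
    exact (sub_eq_zero.1 hg).symm

/-- Every endomorphism is nilpotent or invertible. -/
def LocEnd (X : C) : Prop := (𝟙 X ≠ 0) ∧ ∀ x : End X, IsNilpotent x ∨ IsUnit x

lemma locEnd_of_indec (hHom : ∀ A B : C, Finite (A ⟶ B)) {X : C} (hX : Indecomposable X) :
    LocEnd X := by
  refine ⟨fun h => hX.1 ((IsZero.iff_id_eq_zero X).2 h), ?_⟩
  have : Finite (End X) := hHom X X
  exact nilp_or_unit_of_idem (fun e he => idem_of_indec hX e he)

lemma locEnd_shift {X : C} (hX : LocEnd X) : LocEnd (X⟦(1 : ℤ)⟧) := by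
  refine ⟨fun h => hX.1 ?_, fun x => ?_⟩
  · apply (shiftFunctor C (1 : ℤ)).map_injective
    rw [CategoryTheory.Functor.map_id, Functor.map_zero, h]
  · obtain ⟨y, hy⟩ := (shiftFunctor C (1 : ℤ)).map_surjective x
    have hy' : (shiftFunctor C (1 : ℤ)).mapEnd X y = x := hy
    rcases hX.2 y with ⟨n, hn⟩ | h
    · left
      refine ⟨n, ?_⟩
      rw [← hy', ← map_pow, hn]
      exact Functor.map_zero _ _ _
    · right
      rw [← hy']
      exact h.map _

lemma LocEnd.idem_aux {X : C} (hX : LocEnd X) (e : End X) (he : e * e = e) (h0 : e ≠ 0) :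
    e = 1 := by
  rcases hX.2 e with ⟨n, hn⟩ | h
  · exfalso
    have : ∀ n : ℕ, e ^ (n + 1) = e := by
      intro n
      induction n with
      | zero => simp
      | succ n ih => rw [pow_succ, ih]; exact he
    apply h0
    rw [← this n, pow_succ, hn, zero_mul]
  · obtain ⟨u, hu⟩ := h
    have h1 : e * e = e * 1 := by rw [mul_one]; exact he
    rw [← hu] at h1
    have := u.isUnit.mul_left_cancel h1
    rw [hu] at this
    exact this

lemma LocEnd.idem {X : C} (hX : LocEnd X) (e : X ⟶ X) (he : e ≫ e = e) (h0 : e ≠ 0) :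
    e = 𝟙 X := LocEnd.idem_aux hX e he h0

/-- Splitting between objects with local endomorphism rings: a split epimorphism out of `X` is an
isomorphism. -/
lemma isIso_of_splitEpi {X W : C} (hX : LocEnd X) (hW : 𝟙 W ≠ 0) (h : X ⟶ W) (s : W ⟶ X)
    (hs : s ≫ h = 𝟙 W) : IsIso h := by
  refine ⟨s, ?_, hs⟩
  refine hX.idem _ ?_ ?_
  · rw [Category.assoc, reassoc_of% hs]
  · intro h0
    apply hW
    rw [← hs]
    have : s ≫ (h ≫ s) ≫ h = 0 := by rw [h0]; simp
    rw [Category.assoc, hs, Category.comp_id, hs] at this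
    rw [hs, this]

lemma nilp_of_not_iso {X : C} (hX : LocEnd X) (x : X ⟶ X) (hx : ¬ IsIso x) :
    NilE (x) :=
  (hX.2 x).resolve_right (fun h => hx ((isUnit_iff_isIso x).1 h))

lemma yo3 {Y L X W : C} {f : Y ⟶ L} {g : L ⟶ X} {h : X ⟶ Y⟦(1 : ℤ)⟧}
    (hT : Triangle.mk f g h ∈ distTriang C) (x : X ⟶ W) (hx : g ≫ x = 0) :
    ∃ s : Y⟦(1 : ℤ)⟧ ⟶ W, x = h ≫ s := Triangle.yoneda_exact₃ _ hT x hx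

lemma tr3 {Y L X : C} {f : Y ⟶ L} {g : L ⟶ X} {h : X ⟶ Y⟦(1 : ℤ)⟧}
    (hT : Triangle.mk f g h ∈ distTriang C) (a : Y ⟶ Y) (b : L ⟶ L) (hab : f ≫ b = a ≫ f) :
    ∃ x : X ⟶ X, g ≫ x = b ≫ g ∧ h ≫ (shiftFunctor C (1 : ℤ)).map a = x ≫ h :=
  complete_distinguished_triangle_morphism _ _ hT hT a b hab

/-- The shift is automatically `k`-linear on `End Y` whenever some triangle
`Y → L → X → TY` has `h ≠ 0` and `h` not a split epimorphism. -/
lemma shift_smul {Y L X : C} (hY : LocEnd (Y⟦(1 : ℤ)⟧)) (f : Y ⟶ L) (g : L ⟶ X)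
    (h : X ⟶ Y⟦(1 : ℤ)⟧) (hT : Triangle.mk f g h ∈ distTriang C) (h0 : h ≠ 0)
    (hsp : ∀ s : Y⟦(1 : ℤ)⟧ ⟶ X, s ≫ h ≠ 𝟙 _) (c : k) :
    (shiftFunctor C (1 : ℤ)).map (c • 𝟙 Y) = c • 𝟙 (Y⟦(1 : ℤ)⟧) := by
  obtain ⟨ξ, h1, h2⟩ := tr3 hT (c • 𝟙 Y) (c • 𝟙 L)
    (by
      change f ≫ (c • 𝟙 L) = (c • 𝟙 Y) ≫ f
      rw [Linear.comp_smul, Linear.smul_comp, Category.comp_id, Category.id_comp])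
  obtain ⟨s, hs⟩ := yo3 hT (ξ - c • 𝟙 X) (by
    change g ≫ (ξ - c • 𝟙 X) = 0
    rw [Preadditive.comp_sub, h1]; simp)
  replace hs : ξ - c • 𝟙 X = h ≫ s := hs
  replace hs : ξ = h ≫ s + c • 𝟙 X := by rw [← hs]; simp
  set d : Y⟦(1 : ℤ)⟧ ⟶ Y⟦(1 : ℤ)⟧ := (shiftFunctor C (1 : ℤ)).map (c • 𝟙 Y) - c • 𝟙 _ with hd
  have hdn : h ≫ (d - s ≫ h) = 0 := by
    rw [hd, Preadditive.comp_sub, Preadditive.comp_sub, h2, hs]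
    simp
  have n1 : NilE (d - s ≫ h) := by
    apply nilp_of_not_iso hY
    intro hi
    apply h0
    rw [← cancel_mono (d - s ≫ h), hdn, zero_comp]
  have n2 : NilE (s ≫ h) := by
    apply nilp_of_not_iso hY
    intro hi
    apply hsp (inv (s ≫ h) ≫ s)
    rw [Category.assoc, IsIso.inv_hom_id]
  have n3 : NilE (d) := by
    have : NilE ((d - s ≫ h) + s ≫ h) := nilp_sum hY.2 _ _ n1 n2 hY.1
    rwa [sub_add_cancel] at this
  have : Nontrivial (End (Y⟦(1 : ℤ)⟧)) := ⟨1, 0, hY.1⟩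
  obtain ⟨p, hp⟩ := CharP.exists k
  obtain ⟨n, hpp, hq⟩ := FiniteField.card k p
  have : Fact p.Prime := ⟨hpp⟩
  have : CharP (End (Y⟦(1 : ℤ)⟧)) p :=
    charP_of_injective_algebraMap (algebraMap k (End (Y⟦(1 : ℤ)⟧))).injective p
  have : ExpChar (End (Y⟦(1 : ℤ)⟧)) p := ExpChar.prime hpp
  have hcq : c ^ (p ^ (n : ℕ)) = c := by rw [← hq]; exact FiniteField.pow_card c
  refine eq_of_frob (R := End (Y⟦(1 : ℤ)⟧)) p n
    ((shiftFunctor C (1 : ℤ)).map (c • 𝟙 Y)) (c • 𝟙 _) ?_ ?_ ?_ ?_ n3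
  · exact Commute.smul_right (Commute.one_right _) c
  · exact Nat.one_lt_pow n.2.ne' hpp.one_lt
  · change ((shiftFunctor C (1 : ℤ)).mapEnd Y (c • (1 : End Y))) ^ _ = 
      ((shiftFunctor C (1 : ℤ)).mapEnd Y (c • (1 : End Y)))
    rw [← map_pow, smul_pow, one_pow, hcq]
  · change (c • (1 : End (Y⟦(1 : ℤ)⟧))) ^ _ = c • (1 : End (Y⟦(1 : ℤ)⟧))
    rw [smul_pow, one_pow, hcq]

lemma pow_intertwine {A B : C} (f : A ⟶ B) (x : End A) (y : End B)
    (h : f ≫ (y : B ⟶ B) = (x : A ⟶ A) ≫ f) (n : ℕ) :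
    f ≫ ((y ^ n : End B) : B ⟶ B) = ((x ^ n : End A) : A ⟶ A) ≫ f := by
  induction n with
  | zero =>
    rw [pow_zero, pow_zero]
    exact (Category.comp_id f).trans (Category.id_comp f).symm
  | succ n ih =>
    rw [pow_succ, pow_succ, End.mul_def, End.mul_def, ← Category.assoc, h, Category.assoc, ih,
      Category.assoc]

lemma not_iso_of_intertwine_left {A B : C} (f : A ⟶ B) (x : End A) (y : End B)
    (h : f ≫ (y : B ⟶ B) = (x : A ⟶ A) ≫ f) (hf : f ≠ 0) (hy : IsNilpotent y) : ¬ IsUnit x := by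
  obtain ⟨n, hn⟩ := hy
  intro hx
  have h1 := pow_intertwine f x y h n
  rw [hn] at h1
  have : IsIso ((x ^ n : End A) : A ⟶ A) := (isUnit_iff_isIso _).1 (hx.pow n)
  apply hf
  rw [← cancel_epi ((x ^ n : End A) : A ⟶ A), ← h1]
  exact comp_zero.trans comp_zero.symm

lemma not_iso_of_intertwine_right {A B : C} (f : A ⟶ B) (x : End A) (y : End B)
    (h : f ≫ (y : B ⟶ B) = (x : A ⟶ A) ≫ f) (hf : f ≠ 0) (hx : IsNilpotent x) : ¬ IsUnit y := by
  obtain ⟨n, hn⟩ := hx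
  intro hy
  have h1 := pow_intertwine f x y h n
  rw [hn] at h1
  have : IsIso ((y ^ n : End B) : B ⟶ B) := (isUnit_iff_isIso _).1 (hy.pow n)
  apply hf
  rw [← cancel_mono ((y ^ n : End B) : B ⟶ B), h1]
  exact zero_comp.trans zero_comp.symm

/-- The infinitesimal stabilizer conditions. -/
def InfStab {X Y Z L M : C} (t : WT X Y L) (u : WT L Z M)
    (s : (X ⟶ X) × (Y ⟶ Y) × (Z ⟶ Z) × (L ⟶ L)) : Prop :=
  t.1.1 ≫ s.2.2.2 = s.2.1 ≫ t.1.1 ∧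
  t.1.2.1 ≫ s.1 = s.2.2.2 ≫ t.1.2.1 ∧
  t.1.2.2 ≫ (shiftFunctor C (1 : ℤ)).map s.2.1 = s.1 ≫ t.1.2.2 ∧
  s.2.2.1 ≫ u.1.1 = 0 ∧
  u.1.2.1 ≫ s.2.2.2 = 0 ∧
  u.1.2.2 ≫ (shiftFunctor C (1 : ℤ)).map s.2.2.1 = s.2.2.2 ≫ u.1.2.2

lemma fixesPair_iff {X Y Z L M : C} (a : Aut X × Aut Y × Aut Z × Aut L)
    (t : WT X Y L) (u : WT L Z M) :
    FixesPair a t u ↔ InfStab t u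
      (a.1.hom - 𝟙 X, a.2.1.hom - 𝟙 Y, a.2.2.1.hom - 𝟙 Z, a.2.2.2.hom - 𝟙 L) := by
  unfold FixesPair InfStab
  simp only [Preadditive.comp_sub, Preadditive.sub_comp, Functor.map_sub, CategoryTheory.Functor.map_id,
    Category.comp_id, Category.id_comp, sub_left_inj, sub_eq_zero]
  refine and_congr (Iso.inv_comp_eq _) (and_congr (Iso.inv_comp_eq _)
    (and_congr (Iso.inv_comp_eq _) (and_congr ?_ (and_congr Iff.rfl (Iso.inv_comp_eq _)))))
  exact (Iso.inv_comp_eq _).trans eq_comm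

lemma nilp_of_factor {L W : C} (hW : LocEnd W) (n : L ⟶ W) (w : W ⟶ L)
    (hn : ∀ s : W ⟶ L, s ≫ n ≠ 𝟙 W) (x : L ⟶ L) (hw : x = n ≫ w) : NilE x := by
  obtain ⟨N, hN⟩ : NilE (w ≫ n) := by
    apply nilp_of_not_iso hW
    intro hi
    apply hn (inv (w ≫ n) ≫ w)
    rw [Category.assoc, IsIso.inv_hom_id]
  have h1 := pow_intertwine n x (w ≫ n) (by rw [hw, Category.assoc]) N
  have h2 : ∀ (y : L ⟶ L), y ≫ n = 0 → y ≫ x = 0 := by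
    intro y hy
    rw [hw, ← Category.assoc, hy, zero_comp]
  refine ⟨N + 1, ?_⟩
  rw [pow_succ']
  refine h2 _ (h1.symm.trans ?_)
  exact (congrArg (n ≫ ·) hN).trans comp_zero

section Nilp

variable {X Y Z L M : C} (t : WT X Y L) (u : WT L Z M)

lemma h_not_splitEpi (hX : LocEnd X) (hY : LocEnd (Y⟦(1 : ℤ)⟧)) (hL0 : ¬ IsZero L)
    (s : Y⟦(1 : ℤ)⟧ ⟶ X) : s ≫ t.1.2.2 ≠ 𝟙 _ := by
  intro hs
  have := isIso_of_splitEpi hX hY.1 _ s hs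
  exact hL0 ((Triangle.isZero₂_iff_isIso₃ _ t.2).2 this)

lemma h_not_splitMono (hX : LocEnd X) (hY : LocEnd (Y⟦(1 : ℤ)⟧)) (hL0 : ¬ IsZero L)
    (s : Y⟦(1 : ℤ)⟧ ⟶ X) : t.1.2.2 ≫ s ≠ 𝟙 _ := by
  intro hs
  have hi : IsIso s := isIso_of_splitEpi hY hX.1 s _ hs
  have : t.1.2.2 = inv s := by rw [← cancel_mono s, hs, IsIso.inv_hom_id]
  have h2 : IsIso t.1.2.2 := by rw [this]; infer_instance
  exact hL0 ((Triangle.isZero₂_iff_isIso₃ _ t.2).2 h2)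

lemma f_ne_zero (hX : LocEnd X) (hY : LocEnd (Y⟦(1 : ℤ)⟧)) (hL0 : ¬ IsZero L) : t.1.1 ≠ 0 := by
  intro h0
  obtain ⟨s, hs⟩ := Triangle.coyoneda_exact₁ _ t.2 (𝟙 (Y⟦(1 : ℤ)⟧)) (by
    change 𝟙 _ ≫ (shiftFunctor C (1 : ℤ)).map t.1.1 = 0
    rw [h0, Functor.map_zero, comp_zero])
  exact h_not_splitEpi t hX hY hL0 s hs.symm

lemma g_ne_zero (hX : LocEnd X) (hY : LocEnd (Y⟦(1 : ℤ)⟧)) (hL0 : ¬ IsZero L) :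
    t.1.2.1 ≠ 0 := by
  intro h0
  obtain ⟨s, hs⟩ := Triangle.yoneda_exact₃ _ t.2 (𝟙 X) (by
    change t.1.2.1 ≫ 𝟙 _ = 0
    rw [h0, zero_comp])
  exact h_not_splitMono t hX hY hL0 s hs.symm

lemma n_not_splitEpi (hL : ¬ Nonempty (L ≅ M ⊞ (Z⟦(1 : ℤ)⟧)))
    (s : Z⟦(1 : ℤ)⟧ ⟶ L) : s ≫ u.1.2.2 ≠ 𝟙 _ := by
  intro hs
  apply hL
  have h31 : u.1.2.2 ≫ (shiftFunctor C (1 : ℤ)).map u.1.1 = 0 := comp_distTriang_mor_zero₃₁ _ u.2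
  have hz : (shiftFunctor C (1 : ℤ)).map u.1.1 = 0 := by
    rw [← Category.id_comp ((shiftFunctor C (1 : ℤ)).map u.1.1), ← hs, Category.assoc, h31,
      comp_zero]
  obtain ⟨e, _⟩ := exists_iso_binaryBiproduct_of_distTriang _ (rot_of_distTriang _ u.2) (by
    change -(shiftFunctor C (1 : ℤ)).map u.1.1 = 0
    rw [hz, neg_zero])
  exact ⟨e⟩

lemma l_ne_zero (hL : ¬ Nonempty (L ≅ M ⊞ (Z⟦(1 : ℤ)⟧))) : u.1.1 ≠ 0 := by
  intro h0
  obtain ⟨s, hs⟩ := Triangle.coyoneda_exact₁ _ u.2 (𝟙 (Z⟦(1 : ℤ)⟧)) (by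
    change 𝟙 _ ≫ (shiftFunctor C (1 : ℤ)).map u.1.1 = 0
    rw [h0, Functor.map_zero, comp_zero])
  exact n_not_splitEpi u hL s hs.symm

lemma nilp_lambda (hZ : LocEnd (Z⟦(1 : ℤ)⟧)) (hL : ¬ Nonempty (L ≅ M ⊞ (Z⟦(1 : ℤ)⟧)))
    (x : L ⟶ L) (hx : u.1.2.1 ≫ x = 0) : NilE (x) := by
  obtain ⟨w, hw⟩ := yo3 u.2 x hx
  refine nilp_of_factor hZ u.1.2.2 w (fun s hs => n_not_splitEpi u hL s hs) x hw

lemma infStab_nilp (hX : LocEnd X) (hY : LocEnd Y) (hZ : LocEnd Z) (hL0 : ¬ IsZero L)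
    (hL : ¬ Nonempty (L ≅ M ⊞ (Z⟦(1 : ℤ)⟧)))
    (s : (X ⟶ X) × (Y ⟶ Y) × (Z ⟶ Z) × (L ⟶ L)) (hs : InfStab t u s) :
    NilE (s.1) ∧ NilE (s.2.1) ∧ NilE (s.2.2.1) ∧
      NilE (s.2.2.2) := by
  obtain ⟨h1, h2, h3, h4, h5, h6⟩ := hs
  have nl := nilp_lambda u (locEnd_shift hZ) hL _ h5
  refine ⟨?_, ?_, ?_, nl⟩
  · exact (hX.2 _).resolve_right
      (not_iso_of_intertwine_right _ _ _ h2 (g_ne_zero t hX (locEnd_shift hY) hL0) nl)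
  · exact (hY.2 _).resolve_right
      (not_iso_of_intertwine_left _ _ _ h1 (f_ne_zero t hX (locEnd_shift hY) hL0) nl)
  · apply nilp_of_not_iso hZ
    intro hi
    apply l_ne_zero u hL
    rw [← cancel_epi s.2.2.1, h4, comp_zero]

lemma infStab_smul (hX : LocEnd X) (hY : LocEnd Y) (hZ : LocEnd Z) (hL0 : ¬ IsZero L)
    (hL : ¬ Nonempty (L ≅ M ⊞ (Z⟦(1 : ℤ)⟧))) (c : k)
    (s : (X ⟶ X) × (Y ⟶ Y) × (Z ⟶ Z) × (L ⟶ L)) (hs : InfStab t u s) :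
    InfStab t u (c • s) := by
  obtain ⟨h1, h2, h3, h4, h5, h6⟩ := hs
  have key : ∀ {A B : C} (n : A ⟶ B⟦(1 : ℤ)⟧) (x : B ⟶ B) (y : A ⟶ A)
      (_ : n ≠ 0 → (shiftFunctor C (1 : ℤ)).map (c • 𝟙 B) = c • 𝟙 (B⟦(1 : ℤ)⟧))
      (_ : n ≫ (shiftFunctor C (1 : ℤ)).map x = y ≫ n),
      n ≫ (shiftFunctor C (1 : ℤ)).map (c • x) = (c • y) ≫ n := by
    intro A B n x y hn hxy
    by_cases h0 : n = 0
    · simp [h0]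
    · have : c • x = x ≫ (c • 𝟙 B) := by simp
      rw [this, Functor.map_comp, hn h0, ← Category.assoc, hxy]
      simp
  refine ⟨?_, ?_, ?_, ?_, ?_, ?_⟩
  · simp [h1]
  · simp [h2]
  · exact key _ _ _ (fun h0 => shift_smul (locEnd_shift hY) _ _ _ t.2 h0
      (h_not_splitEpi t hX (locEnd_shift hY) hL0) c) h3
  · simp [h4]
  · simp [h5]
  · exact key _ _ _ (fun h0 => shift_smul (locEnd_shift hZ) _ _ _ u.2 h0
      (n_not_splitEpi u hL) c) h6

end Nilp

lemma infStab_add {X Y Z L M : C} (t : WT X Y L) (u : WT L Z M)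
    (s s' : (X ⟶ X) × (Y ⟶ Y) × (Z ⟶ Z) × (L ⟶ L)) (hs : InfStab t u s) (hs' : InfStab t u s') :
    InfStab t u (s + s') := by
  obtain ⟨h1, h2, h3, h4, h5, h6⟩ := hs
  obtain ⟨h1', h2', h3', h4', h5', h6'⟩ := hs'
  refine ⟨?_, ?_, ?_, ?_, ?_, ?_⟩ <;>
    simp [Functor.map_add, *]

lemma exists_aut {X : C} (x : X ⟶ X) (hx : NilE (x)) :
    ∃ a : Aut X, a.hom - 𝟙 X = x := by
  have h : IsUnit (M := End X) (𝟙 X + x) := hx.isUnit_one_add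
  have : IsIso (𝟙 X + x) := (isUnit_iff_isIso _).1 h
  exact ⟨asIso (𝟙 X + x), by simp⟩

/-- Lemma 3 (stabilizer part): for `X, Y, Z` indecomposable and `L ≇ 0`,
`L ≇ M ⊞ TZ`, the stabilizer of any pair `(t, u) ∈ W_{XY}^L × W_{LZ}^M` under
`Aut(X,Y,Z,L)` has `q`-power order. -/
theorem pair_stabilizer_card_pow (hHom : ∀ A B : C, Finite (A ⟶ B))
    (X Y Z L M : C) (hX : Indecomposable X) (hY : Indecomposable Y)
    (hZ : Indecomposable Z) (hL0 : ¬ IsZero L)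
    (hL : ¬ Nonempty (L ≅ M ⊞ (Z⟦(1 : ℤ)⟧)))
    (t : WT X Y L) (u : WT L Z M) :
    ∃ r : ℕ,
      Nat.card {a : Aut X × Aut Y × Aut Z × Aut L // FixesPair a t u} =
        Fintype.card k ^ r := by
  have lX := locEnd_of_indec hHom hX
  have lY := locEnd_of_indec hHom hY
  have lZ := locEnd_of_indec hHom hZ
  let S : Submodule k ((X ⟶ X) × (Y ⟶ Y) × (Z ⟶ Z) × (L ⟶ L)) :=
    { carrier := {s | InfStab t u s}
      add_mem' := fun {a b} ha hb => infStab_add t u a b ha hb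
      zero_mem' := by
        refine ⟨?_, ?_, ?_, ?_, ?_, ?_⟩ <;> simp
      smul_mem' := fun c s hs => infStab_smul t u lX lY lZ hL0 hL c s hs }
  have := hHom
  have : Finite S := inferInstance
  let φ : {a : Aut X × Aut Y × Aut Z × Aut L // FixesPair a t u} → S := fun a =>
    ⟨_, (fixesPair_iff a.1 t u).1 a.2⟩
  have hφ : Function.Bijective φ := by
    constructor
    · rintro ⟨⟨a, b, c, d⟩, h⟩ ⟨⟨a', b', c', d'⟩, h'⟩ he
      have he' := congrArg Subtype.val he
      simp only [φ, Prod.mk.injEq, sub_left_inj] at he'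
      obtain ⟨e1, e2, e3, e4⟩ := he'
      apply Subtype.ext
      simp only [Prod.mk.injEq]
      exact ⟨Iso.ext e1, Iso.ext e2, Iso.ext e3, Iso.ext e4⟩
    · rintro ⟨⟨x, y, z, w⟩, hs⟩
      obtain ⟨n1, n2, n3, n4⟩ := infStab_nilp t u lX lY lZ hL0 hL _ hs
      obtain ⟨a, rfl⟩ := exists_aut x n1
      obtain ⟨b, rfl⟩ := exists_aut y n2
      obtain ⟨c, rfl⟩ := exists_aut z n3
      obtain ⟨d, rfl⟩ := exists_aut w n4
      exact ⟨⟨(a, b, c, d), (fixesPair_iff _ t u).2 hs⟩, rfl⟩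
  refine ⟨Module.finrank k S, ?_⟩
  rw [Nat.card_congr (Equiv.ofBijective φ hφ), Module.natCard_eq_pow_finrank (K := k) (V := S),
    Nat.card_eq_fintype_card]

end HallTri
end

section
/- Let k be a finite field with q elements and let C be a skeletally small, idempotent-complete, k-linear triangulated category with shift functor T in which all Hom-spaces are finite. Let X, Y, Z be indecomposable objects, let M be a nonzero object, and set L := M ⊕ TZ; assume L ≇ X ⊕ Y. Then for every pair (t,u) ∈ W_{XY}^L × W_{LZ}^M, the stabilizer of (t,u) under the action of Aut(X,Y,Z,L) has cardinality a power of q. -/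
open CategoryTheory CategoryTheory.Limits CategoryTheory.Pretriangulated

universe v u

namespace HallTri

variable {k : Type} [Field k] [Fintype k]
variable {C : Type u} [Category.{v} C] [HasZeroObject C] [HasShift C ℤ] [Preadditive C]
  [∀ n : ℤ, (shiftFunctor C n).Additive] [Pretriangulated C] [IsTriangulated C]
  [Linear k C] [IsIdempotentComplete C] [HasBinaryBiproducts C]

theorem exists_idem_pow {R : Type*} [Monoid R] [Finite R] (x : R) :
    ∃ n, 0 < n ∧ x ^ n * x ^ n = x ^ n := by
  obtain ⟨i, j, hne, hij⟩ := Finite.exists_ne_map_eq_of_infinite (fun n : ℕ => x ^ n)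
  wlog hlt : i < j generalizing i j
  · exact this j i hne.symm hij.symm (by omega)
  obtain ⟨p, rfl⟩ := Nat.exists_eq_add_of_lt hlt
  have h1 : ∀ c n, i ≤ n → x ^ (n + c * (p + 1)) = x ^ n := by
    intro c
    induction c with
    | zero => intro n _; simp
    | succ c ih =>
      intro n hn
      rw [← ih n hn]
      obtain ⟨d, rfl⟩ := Nat.exists_eq_add_of_le hn
      have e1 : i + d + (c + 1) * (p + 1) = (i + p + 1) + (d + c * (p + 1)) := by ring
      have e2 : i + d + c * (p + 1) = i + (d + c * (p + 1)) := by ring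
      rw [e1, e2, pow_add x (i + p + 1), pow_add x i]
      exact congrArg (· * x ^ (d + c * (p + 1))) hij.symm
  refine ⟨(i + 1) * (p + 1), by positivity, ?_⟩
  rw [← pow_add]
  exact h1 _ _ (by nlinarith)


theorem idem_trivial_s13 {D : Type u} [Category.{v} D] [Preadditive D] [HasZeroObject D]
    [IsIdempotentComplete D] [HasBinaryBiproducts D] {X : D} (hX : Indecomposable X)
    (e : X ⟶ X) (he : e ≫ e = e) : e = 0 ∨ e = 𝟙 X := by
  obtain ⟨P, i, a, h1, h2⟩ := IsIdempotentComplete.idempotents_split X e he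
  obtain ⟨Q, j, b, h3, h4⟩ := IsIdempotentComplete.idempotents_split X (𝟙 X - e)
    (by simp [he])
  have hib : i ≫ b = 0 := by
    have : i ≫ b ≫ j = 0 := by rw [h4, ← h2]; simp [reassoc_of% h1]
    calc i ≫ b = (i ≫ b ≫ j) ≫ b := by simp [h3]
      _ = 0 := by rw [this, zero_comp]
  have hja : j ≫ a = 0 := by
    have : j ≫ a ≫ i = 0 := by
      have h5 : e = 𝟙 X - b ≫ j := by rw [h4]; simp
      rw [h2, h5]; simp [reassoc_of% h3]
    calc j ≫ a = (j ≫ a ≫ i) ≫ a := by simp [h1]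
      _ = 0 := by rw [this, zero_comp]
  let φ : X ≅ P ⊞ Q :=
    { hom := biprod.lift a b
      inv := biprod.desc i j
      hom_inv_id := by simp [h2, h4]
      inv_hom_id := by
        apply biprod.hom_ext'
        · apply biprod.hom_ext <;> simp [h1, hib]
        · apply biprod.hom_ext <;> simp [h3, hja] }
  rcases hX.2 P Q φ with h | h
  · left; rw [← h2, h.eq_of_tgt a 0, zero_comp]
  · right
    have : 𝟙 X - e = 0 := by rw [← h4, h.eq_of_tgt b 0, zero_comp]
    exact (sub_eq_zero.1 this).symm

theorem iso_or_nilp {D : Type u} [Category.{v} D] [Preadditive D] [HasZeroObject D]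
    [IsIdempotentComplete D] [HasBinaryBiproducts D] {X : D} (hX : Indecomposable X)
    (hf : Finite (X ⟶ X)) (x : End X) : IsUnit x ∨ IsNilpotent x := by
  have : Finite (End X) := hf
  obtain ⟨n, hn, h⟩ := exists_idem_pow x
  rcases idem_trivial_s13 hX (x ^ n : End X) h with h0 | h1
  · right; exact ⟨n, h0⟩
  · left
    have h1' : x ^ n = 1 := h1
    exact IsUnit.of_pow_eq_one h1' hn.ne'

theorem pow_comm {D : Type u} [Category.{v} D] {A B : D} (h : A ⟶ B) (x : End A) (y : End B)
    (H : x ≫ h = h ≫ y) (n : ℕ) : (x ^ n : End A) ≫ h = h ≫ (y ^ n : End B) := by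
  induction n with
  | zero => simp [End.one_def]
  | succ n ih =>
    rw [pow_succ, pow_succ, End.mul_def, End.mul_def, Category.assoc, ih, ← Category.assoc, H,
      Category.assoc]

/-- If a nonzero morphism intertwines a unit and a nilpotent, contradiction. -/
theorem nilp_transfer {D : Type u} [Category.{v} D] [Preadditive D] {A B : D} (h : A ⟶ B)
    (h0 : h ≠ 0) (x : End A) (y : End B) (H : x ≫ h = h ≫ y) :
    ¬ (IsUnit x ∧ IsNilpotent y) ∧ ¬ (IsNilpotent x ∧ IsUnit y) := by
  constructor
  · rintro ⟨hx, n, hn⟩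
    have h1 := pow_comm h x y H n
    rw [hn] at h1
    have hx' := hx.pow n
    rw [isUnit_iff_isIso] at hx'
    have h2 : (x ^ n : End A) ≫ h = 0 := h1.trans comp_zero
    exact h0 ((cancel_epi (x ^ n : End A)).1 (h2.trans comp_zero.symm))
  · rintro ⟨⟨n, hn⟩, hy⟩
    have h1 := pow_comm h x y H n
    rw [hn] at h1
    have hy' := hy.pow n
    rw [isUnit_iff_isIso] at hy'
    have h2 : h ≫ (y ^ n : End B) = 0 := h1.symm.trans zero_comp
    exact h0 ((cancel_mono (y ^ n : End B)).1 (h2.trans zero_comp.symm))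

section
variable {C : Type u} [Category.{v} C] [HasZeroObject C] [HasShift C ℤ] [Preadditive C]
  [∀ n : ℤ, (shiftFunctor C n).Additive] [Pretriangulated C] [HasBinaryBiproducts C]

set_option linter.unusedSectionVars false in
theorem split_of_card (hHom : ∀ A B : C, Finite (A ⟶ B)) {M Z : C} (m : M ⟶ (M ⊞ Z))
    (n : (M ⊞ Z) ⟶ Z) (hmn : ∀ (A : C) (w : A ⟶ M ⊞ Z), w ≫ n = 0 → ∃ v : A ⟶ M, w = v ≫ m) :
    ∃ s : Z ⟶ M ⊞ Z, s ≫ n = 𝟙 Z := by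
  have := hHom Z M
  have := hHom Z Z
  have := hHom Z (M ⊞ Z)
  let ψ : (Z ⟶ M ⊞ Z) →+ (Z ⟶ Z) :=
    { toFun := fun w => w ≫ n
      map_zero' := by simp
      map_add' := by simp }
  have hc : Nat.card (Z ⟶ M ⊞ Z) = Nat.card (Z ⟶ M) * Nat.card (Z ⟶ Z) := by
    rw [← Nat.card_prod]
    exact Nat.card_congr
      { toFun := fun w => (w ≫ biprod.fst, w ≫ biprod.snd)
        invFun := fun p => biprod.lift p.1 p.2
        left_inv := fun w => by apply biprod.hom_ext <;> simp
        right_inv := fun p => by simp }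
  have hker : Nat.card ψ.ker ≤ Nat.card (Z ⟶ M) := by
    choose v hv using hmn Z
    refine Nat.card_le_card_of_injective (fun w : ψ.ker => v w.1 w.2) ?_
    intro w w' h
    apply Subtype.ext
    rw [hv w.1 w.2, hv w'.1 w'.2]
    exact congrArg (· ≫ m) h
  have hcard : Nat.card (Z ⟶ M ⊞ Z) = Nat.card ψ.range * Nat.card ψ.ker := by
    rw [AddSubgroup.card_eq_card_quotient_mul_card_addSubgroup ψ.ker]
    rw [Nat.card_congr (QuotientAddGroup.quotientKerEquivRange ψ).toEquiv]
  have hpos : 0 < Nat.card (Z ⟶ M) := Nat.card_pos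
  have hge : Nat.card (Z ⟶ Z) ≤ Nat.card ψ.range := by
    by_contra hlt
    push Not at hlt
    have : Nat.card ψ.range * Nat.card ψ.ker < Nat.card (Z ⟶ M) * Nat.card (Z ⟶ Z) := by
      calc _ ≤ Nat.card ψ.range * Nat.card (Z ⟶ M) := Nat.mul_le_mul_left _ hker
        _ < Nat.card (Z ⟶ Z) * Nat.card (Z ⟶ M) := Nat.mul_lt_mul_of_pos_right hlt hpos
        _ = _ := mul_comm _ _
    omega
  have htop : ψ.range = ⊤ := AddSubgroup.eq_top_of_le_card _ hge
  have : 𝟙 Z ∈ ψ.range := by rw [htop]; trivial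
  exact this

set_option linter.unusedSectionVars false in
theorem isIso_one_add_s13 {X : C} (x : X ⟶ X) (hx : IsNilpotent (R := End X) x) :
    IsIso (𝟙 X + x) := by
  have := hx.isUnit_one_add
  rwa [isUnit_iff_isIso] at this

theorem units_aux (hHom : ∀ A B : C, Finite (A ⟶ B)) [IsIdempotentComplete C]
    {X Y Z M L : C} (hX : Indecomposable X) (hY : Indecomposable Y) (hM : ¬ IsZero M)
    {f : Y ⟶ L} {g : L ⟶ X} {h : X ⟶ Y⟦(1 : ℤ)⟧} (hT : Triangle.mk f g h ∈ distTriang C)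
    (h0 : h ≠ 0) {m : M ⟶ L} {n : L ⟶ Z⟦(1 : ℤ)⟧}
    (hU : Triangle.mk (0 : Z ⟶ M) m n ∈ distTriang C)
    (x : X ⟶ X) (y : Y ⟶ Y) (z : Z ⟶ Z) (l : L ⟶ L)
    (e1 : f ≫ l = y ≫ f) (e2 : l ≫ g = g ≫ x)
    (e3 : x ≫ h = h ≫ (shiftFunctor C (1 : ℤ)).map y)
    (e4 : m ≫ l = 0) (e5 : l ≫ n = n ≫ (shiftFunctor C (1 : ℤ)).map z) :
    IsIso (𝟙 X + x) ∧ IsIso (𝟙 Y + y) ∧ IsIso (𝟙 Z + z) ∧ IsIso (𝟙 L + l) := by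
  have hmono : Mono m := Triangle.mono₂ _ hU rfl
  have hmap : ∀ (y : End Y), IsUnit y →
      IsUnit (M := End (Y⟦(1 : ℤ)⟧)) ((shiftFunctor C (1 : ℤ)).map y) :=
    fun y hy => hy.map (Functor.mapEnd Y (shiftFunctor C (1 : ℤ)))
  have hmap' : ∀ (y : End Y), IsNilpotent y →
      IsNilpotent (R := End (Y⟦(1 : ℤ)⟧)) ((shiftFunctor C (1 : ℤ)).map y) := by
    rintro y ⟨n, hn⟩
    refine ⟨n, ?_⟩
    have := (map_pow (Functor.mapEnd Y (shiftFunctor C (1 : ℤ))) y n).symm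
    refine this.trans ?_
    rw [hn]
    exact (shiftFunctor C (1 : ℤ)).map_zero _ _
  have key := nilp_transfer h h0 x ((shiftFunctor C (1 : ℤ)).map y) e3
  have hxn : IsNilpotent (R := End X) x ∧ IsNilpotent (R := End Y) y := by
    rcases iso_or_nilp hX (hHom X X) x with hx | hx <;>
      rcases iso_or_nilp hY (hHom Y Y) y with hy | hy
    · exfalso
      rw [isUnit_iff_isIso] at hx hy
      have : IsIso l := isIso₂_of_isIso₁₃ (T := Triangle.mk f g h) (T' := Triangle.mk f g h)
        { hom₁ := y, hom₂ := l, hom₃ := x, comm₁ := e1, comm₂ := e2.symm, comm₃ := e3.symm }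
        hT hT hy hx
      have hm0 : m = 0 := (cancel_mono l).1 (e4.trans zero_comp.symm)
      apply hM
      rw [IsZero.iff_id_eq_zero]
      apply (cancel_mono m).1
      rw [hm0]; simp
    · exact (key.1 ⟨hx, hmap' y hy⟩).elim
    · exact (key.2 ⟨hx, hmap y hy⟩).elim
    · exact ⟨hx, hy⟩
  have hx := isIso_one_add_s13 (C := C) x hxn.1
  have hy := isIso_one_add_s13 (C := C) y hxn.2
  have c1 : f ≫ (𝟙 L + l) = (𝟙 Y + y) ≫ f := by simp [e1]
  have c2 : g ≫ (𝟙 X + x) = (𝟙 L + l) ≫ g := by simp [e2]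
  have c3 : h ≫ (shiftFunctor C (1 : ℤ)).map (𝟙 Y + y) = (𝟙 X + x) ≫ h := by
    simp [e3, Functor.map_add]
  have c4 : (0 : Z ⟶ M) ≫ 𝟙 M = (𝟙 Z + z) ≫ (0 : Z ⟶ M) := by simp
  have c5 : m ≫ (𝟙 L + l) = 𝟙 M ≫ m := by simp [e4]
  have c6 : n ≫ (shiftFunctor C (1 : ℤ)).map (𝟙 Z + z) = (𝟙 L + l) ≫ n := by
    simp [e5, Functor.map_add]
  have hid : IsIso (𝟙 M) := inferInstance
  have hl : IsIso (𝟙 L + l) := isIso₂_of_isIso₁₃ (T := Triangle.mk f g h)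
      (T' := Triangle.mk f g h)
      { hom₁ := 𝟙 Y + y, hom₂ := 𝟙 L + l, hom₃ := 𝟙 X + x, comm₁ := c1,
        comm₂ := c2, comm₃ := c3 } hT hT hy hx
  have hz : IsIso (𝟙 Z + z) := isIso₁_of_isIso₂₃ (T := Triangle.mk (0 : Z ⟶ M) m n)
      (T' := Triangle.mk (0 : Z ⟶ M) m n)
      { hom₁ := 𝟙 Z + z, hom₂ := 𝟙 M, hom₃ := 𝟙 L + l, comm₁ := c4,
        comm₂ := c5, comm₃ := c6 } hU hU hid hl
  exact ⟨hx, hy, hz, hl⟩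

end

theorem card_pow (V : Type*) [AddCommGroup V] [Module k V] [Finite V] :
    ∃ r : ℕ, Nat.card V = Fintype.card k ^ r := by
  have := Fintype.ofFinite V
  exact ⟨Module.finrank k V, by rw [Nat.card_eq_fintype_card]; exact Module.card_eq_pow_finrank⟩

theorem fixes_iff {X Y Z L M : C} (a : Aut X × Aut Y × Aut Z × Aut L)
    (t : WT X Y L) (u : WT L Z M) (hu : u.1.1 = 0) : FixesPair a t u ↔
      (t.1.1 ≫ (a.2.2.2.hom - 𝟙 L) = (a.2.1.hom - 𝟙 Y) ≫ t.1.1 ∧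
      (a.2.2.2.hom - 𝟙 L) ≫ t.1.2.1 = t.1.2.1 ≫ (a.1.hom - 𝟙 X) ∧
      (a.1.hom - 𝟙 X) ≫ t.1.2.2 = t.1.2.2 ≫ (shiftFunctor C (1 : ℤ)).map (a.2.1.hom - 𝟙 Y) ∧
      u.1.2.1 ≫ (a.2.2.2.hom - 𝟙 L) = 0 ∧
      (a.2.2.2.hom - 𝟙 L) ≫ u.1.2.2 =
        u.1.2.2 ≫ (shiftFunctor C (1 : ℤ)).map (a.2.2.1.hom - 𝟙 Z)) := by
  have hs : ∀ {A B : C} (i : Aut A) (p : A ⟶ B) (q : A ⟶ B),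
      i.inv ≫ p = q ↔ p = i.hom ≫ q := fun i p q => Iso.inv_comp_eq (α := i)
  have r1 := hs a.2.1 (t.1.1 ≫ a.2.2.2.hom) t.1.1
  have r2 := hs a.2.2.2 (t.1.2.1 ≫ a.1.hom) t.1.2.1
  have r3 := hs a.1 (t.1.2.2 ≫ (shiftFunctor C (1 : ℤ)).map a.2.1.hom) t.1.2.2
  have r5 := hs a.2.2.2 (u.1.2.2 ≫ (shiftFunctor C (1 : ℤ)).map a.2.2.1.hom) u.1.2.2
  have r4 : a.2.2.1.inv ≫ u.1.1 = u.1.1 := by rw [hu]; exact comp_zero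
  refine Iff.trans (and_congr r1 (and_congr r2 (and_congr r3
    (and_congr (iff_of_true r4 trivial) (and_congr Iff.rfl r5))))) ?_
  generalize (a.1.hom : X ⟶ X) = ξ
  generalize (a.2.1.hom : Y ⟶ Y) = η
  generalize (a.2.2.1.hom : Z ⟶ Z) = ζ
  generalize (a.2.2.2.hom : L ⟶ L) = lam
  simp only [Preadditive.comp_sub, Preadditive.sub_comp, Functor.map_sub, Category.comp_id,
    Category.id_comp, CategoryTheory.Functor.map_id, true_and, sub_left_inj, sub_eq_zero]
  constructor
  · rintro ⟨h1, h2, h3, h4, h5⟩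
    exact ⟨h1, h2.symm, h3.symm, h4, h5.symm⟩
  · rintro ⟨h1, h2, h3, h4, h5⟩
    exact ⟨h1, h2.symm, h3.symm, h4, h5.symm⟩

theorem card_aux (hHom : ∀ A B : C, Finite (A ⟶ B))
    {X Y Z M L : C} (hX : Indecomposable X) (hY : Indecomposable Y)
    (hM : ¬ IsZero M) (t : WT X Y L) (u : WT L Z M) (hu : u.1.1 = 0) (h0 : t.1.2.2 ≠ 0) :
    ∃ r : ℕ, Nat.card {a : Aut X × Aut Y × Aut Z × Aut L // FixesPair a t u} =
        Fintype.card k ^ r := by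
  have hfix := fun a => fixes_iff a t u hu
  obtain ⟨⟨f, g, h⟩, hT⟩ := t
  obtain ⟨⟨l, m, n⟩, hU⟩ := u
  dsimp only at hu h0 hT hU hfix
  subst hu
  have hepi : Epi n := Triangle.epi₃ _ hU rfl
  let T := shiftFunctor C (1 : ℤ)
  let Λ : Submodule k (L ⟶ L) :=
    { carrier := {l | m ≫ l = 0 ∧ f ≫ l ≫ g = 0}
      zero_mem' := by simp
      add_mem' := by
        rintro a b ⟨h1, h2⟩ ⟨h3, h4⟩
        simp [h1, h2, h3, h4]
      smul_mem' := by
        rintro c a ⟨h1, h2⟩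
        simp [h1, h2] }
  let K : Submodule k ((Y⟦(1 : ℤ)⟧ ⟶ Y⟦(1 : ℤ)⟧) × (X ⟶ X)) :=
    { carrier := {p | p.1 ≫ f⟦(1 : ℤ)⟧' = 0 ∧ g ≫ p.2 = 0 ∧ p.2 ≫ h = h ≫ p.1}
      zero_mem' := by simp
      add_mem' := by
        rintro a b ⟨h1, h2, h3⟩ ⟨h4, h5, h6⟩
        simp [h1, h2, h3, h4, h5, h6]
      smul_mem' := by
        rintro c a ⟨h1, h2, h3⟩
        simp [h1, h2, h3] }
  have hex : ∀ l : Λ, ∃ (x : X ⟶ X) (y : Y ⟶ Y) (z : Z ⟶ Z),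
      f ≫ l.1 = y ≫ f ∧ l.1 ≫ g = g ≫ x ∧ x ≫ h = h ≫ y⟦(1 : ℤ)⟧' ∧
        l.1 ≫ n = n ≫ z⟦(1 : ℤ)⟧' := by
    rintro ⟨l, hl1, hl2⟩
    obtain ⟨y, hy⟩ := Triangle.coyoneda_exact₂ _ hT (f ≫ l) ((Category.assoc _ _ _).trans hl2)
    obtain ⟨x, hx1, hx2⟩ := complete_distinguished_triangle_morphism _ _ hT hT y l hy
    obtain ⟨b, hb⟩ : ∃ b : Z⟦(1 : ℤ)⟧ ⟶ L, l = n ≫ b := Triangle.yoneda_exact₃ _ hU l hl1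
    obtain ⟨z, hz⟩ := (shiftFunctor C (1 : ℤ)).map_surjective (b ≫ n)
    refine ⟨x, y, z, hy, hx1.symm, hx2.symm, ?_⟩
    dsimp only
    rw [hz, hb, Category.assoc]
  choose x0 y0 z0 p1 p2 p3 p4 using hex
  have hdata : ∀ (l : Λ) (p : K),
      f ≫ l.1 = (y0 l + T.preimage p.1.1) ≫ f ∧ l.1 ≫ g = g ≫ (x0 l + p.1.2) ∧
      (x0 l + p.1.2) ≫ h = h ≫ (y0 l + T.preimage p.1.1)⟦(1 : ℤ)⟧' := by
    rintro l ⟨⟨a, b⟩, h1, h2, h3⟩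
    dsimp at h1 h2 h3 ⊢
    have ha : (shiftFunctor C (1 : ℤ)).map (T.preimage a) = a := T.map_preimage _
    have haf : T.preimage a ≫ f = 0 := by
      apply T.map_injective
      rw [T.map_comp, T.map_preimage, T.map_zero]; exact h1
    refine ⟨?_, ?_, ?_⟩
    · rw [Preadditive.add_comp, haf, add_zero, p1]
    · rw [Preadditive.comp_add, h2, add_zero, p2]
    · rw [Preadditive.add_comp, Functor.map_add, Preadditive.comp_add, ha, p3, h3]
  have hunit := fun (l : Λ) (p : K) => units_aux hHom hX hY hM hT h0 hU _ _ (z0 l) l.1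
    (hdata l p).1 (hdata l p).2.1 (hdata l p).2.2 l.2.1 (p4 l)
  let F : Λ × K → {a : Aut X × Aut Y × Aut Z × Aut L //
      FixesPair a (⟨⟨f, g, h⟩, hT⟩ : WT X Y L) (⟨⟨0, m, n⟩, hU⟩ : WT L Z M)} := fun q =>
    ⟨(@asIso _ _ _ _ _ (hunit q.1 q.2).1, @asIso _ _ _ _ _ (hunit q.1 q.2).2.1,
      @asIso _ _ _ _ _ (hunit q.1 q.2).2.2.1, @asIso _ _ _ _ _ (hunit q.1 q.2).2.2.2), by
      rw [hfix]
      simp only [asIso_hom, add_sub_cancel_left]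
      exact ⟨(hdata q.1 q.2).1, (hdata q.1 q.2).2.1, (hdata q.1 q.2).2.2, q.1.2.1, p4 q.1⟩⟩
  have hF : Function.Bijective F := by
    constructor
    · rintro ⟨l, p⟩ ⟨l', p'⟩ hq
      have hq' := congrArg Subtype.val hq
      have c1 : 𝟙 X + (x0 l + p.1.2) = 𝟙 X + (x0 l' + p'.1.2) :=
        congrArg (fun a => a.1.hom) hq'
      have c2 : 𝟙 Y + (y0 l + T.preimage p.1.1) = 𝟙 Y + (y0 l' + T.preimage p'.1.1) :=
        congrArg (fun a => a.2.1.hom) hq'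
      have c4 : 𝟙 L + l.1 = 𝟙 L + l'.1 :=
        congrArg (fun a => a.2.2.2.hom) hq'
      have : l = l' := Subtype.ext (add_left_cancel c4)
      subst this
      have d1 := add_left_cancel (add_left_cancel c1)
      have d2 := congrArg T.map (add_left_cancel (add_left_cancel c2))
      rw [T.map_preimage, T.map_preimage] at d2
      exact Prod.ext rfl (Subtype.ext (Prod.ext d2 d1))
    · rintro ⟨⟨ξ, η, ζ, lam⟩, ha⟩
      obtain ⟨h1, h2, h3, h4, h5⟩ := (hfix _).1 ha
      dsimp only at h1 h2 h3 h4 h5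
      have hfg : f ≫ g = 0 := comp_distTriang_mor_zero₁₂ _ hT
      let l : Λ := ⟨lam.hom - 𝟙 L, h4, by rw [h2, reassoc_of% hfg, zero_comp]⟩
      have hl : l.1 = lam.hom - 𝟙 L := rfl
      have q1 := p1 l
      have q2 := p2 l
      have q3 := p3 l
      have q4 := p4 l
      rw [hl] at q1 q2 q4
      let p : K := ⟨(T.map ((η.hom - 𝟙 Y) - y0 l), (ξ.hom - 𝟙 X) - x0 l), by
        refine ⟨?_, ?_, ?_⟩
        · dsimp only
          rw [← T.map_comp, Preadditive.sub_comp, ← h1, ← q1, sub_self, T.map_zero]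
        · dsimp only
          rw [Preadditive.comp_sub, ← h2, ← q2, sub_self]
        · dsimp only
          rw [Preadditive.sub_comp, T.map_sub, Preadditive.comp_sub, h3, q3]⟩
      refine ⟨(l, p), Subtype.ext ?_⟩
      refine Prod.ext (Iso.ext ?_) (Prod.ext (Iso.ext ?_) (Prod.ext (Iso.ext ?_) (Iso.ext ?_)))
      · change 𝟙 X + (x0 l + ((ξ.hom - 𝟙 X) - x0 l)) = ξ.hom
        abel
      · change 𝟙 Y + (y0 l + T.preimage (T.map ((η.hom - 𝟙 Y) - y0 l))) = η.hom
        rw [T.preimage_map]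
        abel
      · change 𝟙 Z + z0 l = ζ.hom
        have : ζ.hom - 𝟙 Z = z0 l := T.map_injective ((cancel_epi n).1 (h5.symm.trans q4))
        rw [← this]
        abel
      · change 𝟙 L + (lam.hom - 𝟙 L) = lam.hom
        abel
  have := hHom L L
  have := hHom X X
  have := hHom (Y⟦(1 : ℤ)⟧) (Y⟦(1 : ℤ)⟧)
  obtain ⟨r, hr⟩ := card_pow (k := k) Λ
  obtain ⟨s, hs⟩ := card_pow (k := k) K
  refine ⟨r + s, ?_⟩
  rw [← Nat.card_congr (Equiv.ofBijective F hF), Nat.card_prod, hr, hs, pow_add]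

/-- Lemma 4(1) (stabilizer part): for `X, Y, Z` indecomposable, `M` nonzero,
`L = M ⊞ TZ` and `L ≇ X ⊞ Y`, the stabilizer of any pair
`(t, u) ∈ W_{XY}^L × W_{LZ}^M` under `Aut(X,Y,Z,L)` has `q`-power order. -/
theorem pair_stabilizer_card_pow_split (hHom : ∀ A B : C, Finite (A ⟶ B))
    (X Y Z M : C) (hX : Indecomposable X) (hY : Indecomposable Y)
    (hZ : Indecomposable Z) (hM : ¬ IsZero M)
    (hL : ¬ Nonempty ((M ⊞ (Z⟦(1 : ℤ)⟧) : C) ≅ X ⊞ Y))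
    (t : WT X Y (M ⊞ (Z⟦(1 : ℤ)⟧))) (u : WT (M ⊞ (Z⟦(1 : ℤ)⟧)) Z M) :
    ∃ r : ℕ,
      Nat.card {a : Aut X × Aut Y × Aut Z × Aut (M ⊞ (Z⟦(1 : ℤ)⟧)) // FixesPair a t u} =
        Fintype.card k ^ r := by
  have h0 : t.1.2.2 ≠ 0 := by
    intro h0
    obtain ⟨e, -⟩ := exists_iso_binaryBiproduct_of_distTriang _ t.2 h0
    exact hL ⟨e ≪≫ biprod.braiding _ _⟩
  have hu : u.1.1 = 0 := by
    obtain ⟨s, hs⟩ := split_of_card hHom u.1.2.1 u.1.2.2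
      (fun A w hw => Triangle.coyoneda_exact₃ _ u.2 w hw)
    have : Epi u.1.2.2 := by
      have : IsSplitEpi u.1.2.2 := ⟨⟨⟨s, hs⟩⟩⟩
      infer_instance
    exact Triangle.mor₁_eq_zero_of_epi₃ _ u.2 this
  exact card_aux hHom hX hY hM t u hu h0

end HallTri
end

section
/- Let k be a finite field and let C be a skeletally small, idempotent-complete, k-linear triangulated category with shift functor T in which all Hom-spaces are finite. Let X, Y, Z be indecomposable objects and let M be a nonzero object with M ≇ Y; set L := M ⊕ TZ and assume L ≅ X ⊕ Y. Then the group Aut(X,Y,Z,L) acts transitively on W_{XY}^L × W_{LZ}^M; that is, the orbit count N_{XYZ}^{LM} equals 1. -/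
open CategoryTheory CategoryTheory.Limits CategoryTheory.Pretriangulated

universe v u

namespace HallTri

variable {k : Type} [Field k] [Fintype k]
variable {C : Type u} [Category.{v} C] [HasZeroObject C] [HasShift C ℤ] [Preadditive C]
  [∀ n : ℤ, (shiftFunctor C n).Additive] [Pretriangulated C] [IsTriangulated C]
  [Linear k C] [IsIdempotentComplete C] [HasBinaryBiproducts C]

/-- The orbit relation on `W_{XY}^L × W_{LZ}^M` for the action of
`Aut(X,Y,Z,L) = Aut X × Aut Y × Aut Z × Aut L`, where `(ξ,η,ζ,λ)` sends
`((f,g,h),(l,m,n))` to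
`((λ∘f∘η⁻¹, ξ∘g∘λ⁻¹, (Tη)∘h∘ξ⁻¹), (l∘ζ⁻¹, λ∘m, (Tζ)∘n∘λ⁻¹))`. -/
def PairRelT (X Y Z L M : C) (p q : WT X Y L × WT L Z M) : Prop :=
  ∃ (ξ : Aut X) (η : Aut Y) (ζ : Aut Z) (l : Aut L),
    q.1.1.1 = η.inv ≫ p.1.1.1 ≫ l.hom ∧
    q.1.1.2.1 = l.inv ≫ p.1.1.2.1 ≫ ξ.hom ∧
    q.1.1.2.2 = ξ.inv ≫ p.1.1.2.2 ≫ (shiftFunctor C (1 : ℤ)).map η.hom ∧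
    q.2.1.1 = ζ.inv ≫ p.2.1.1 ∧
    q.2.1.2.1 = p.2.1.2.1 ≫ l.hom ∧
    q.2.1.2.2 = l.inv ≫ p.2.1.2.2 ≫ (shiftFunctor C (1 : ℤ)).map ζ.hom



/-- In a finite ring with trivial idempotents, `a + b = 1` forces a unit. -/
theorem isUnit_or_of_add {R : Type*} [Ring R] [Finite R]
    (hid : ∀ e : R, e * e = e → e = 0 ∨ e = 1) (a b : R) (hab : a + b = 1) :
    IsUnit a ∨ IsUnit b := by
  obtain ⟨n, hn, h⟩ := exists_pow_idem a
  rcases hid _ h with h0 | h1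
  · right
    have : IsNilpotent a := ⟨n, h0⟩
    have hb : b = 1 - a := by rw [← hab]; abel
    rw [hb]
    exact this.isUnit_one_sub
  · left
    exact IsUnit.of_pow_eq_one h1 hn.ne'

section aux

variable {D : Type u} [Category.{v} D] [Preadditive D]

theorem idem_of_indecomposable [IsIdempotentComplete D] [HasBinaryBiproducts D] {X : D}
    (hX : Indecomposable X) (e : X ⟶ X) (he : e ≫ e = e) : e = 0 ∨ e = 𝟙 X := by
  obtain ⟨A, i, p, h1, h2⟩ := IsIdempotentComplete.idempotents_split X e he
  obtain ⟨B, j, q, h3, h4⟩ := IsIdempotentComplete.idempotents_split X (𝟙 X - e)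
    (by simp [he])
  have hiq : i ≫ q = 0 := by
    have : i ≫ q = (i ≫ p) ≫ i ≫ (q ≫ j) ≫ q := by simp [h1, h3]
    rw [this, h4]
    have : i ≫ e = i := by rw [← h2, reassoc_of% h1]
    simp [reassoc_of% this]
  have hjp : j ≫ p = 0 := by
    have : j ≫ p = (j ≫ q) ≫ j ≫ (p ≫ i) ≫ p := by simp [h1, h3]
    rw [this, Category.assoc, reassoc_of% h4, h2]
    simp [reassoc_of% he]
  let φ : X ≅ A ⊞ B :=
    { hom := biprod.lift p q
      inv := biprod.desc i j
      hom_inv_id := by simp [h2, h4]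
      inv_hom_id := by ext <;> simp [h1, h3, hiq, hjp] }
  rcases hX.2 A B φ with h | h
  · left; rw [← h2, h.eq_of_tgt p 0, zero_comp]
  · right
    have : 𝟙 X - e = 0 := by rw [← h4, h.eq_of_tgt q 0, zero_comp]
    exact (sub_eq_zero.mp this).symm

/-- A split epi from an object with trivial idempotents to a nonzero object is an iso. -/
theorem isIso_of_splitEpi_s14 {A W : D}
    (hA : ∀ e : A ⟶ A, e ≫ e = e → e = 0 ∨ e = 𝟙 A) (hW : ¬ IsZero W)
    (i : W ⟶ A) (p : A ⟶ W) (h : i ≫ p = 𝟙 W) : IsIso p := by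
  rcases hA (p ≫ i) (by simp [reassoc_of% h]) with h0 | h1
  · exfalso
    apply hW
    rw [IsZero.iff_id_eq_zero]
    have : 𝟙 W = i ≫ (p ≫ i) ≫ p := by simp [h]
    rw [this, h0]; simp
  · exact ⟨i, h1, h⟩

/-- Split short exact sequences. -/
structure Spl {A B E : D} (f : A ⟶ B) (g : B ⟶ E) (s : E ⟶ B) (r : B ⟶ A) : Prop where
  fr : f ≫ r = 𝟙 A
  sg : s ≫ g = 𝟙 E
  fg : f ≫ g = 0
  sr : s ≫ r = 0
  tot : r ≫ f + g ≫ s = 𝟙 B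

theorem Spl.flip {A B E : D} {f : A ⟶ B} {g : B ⟶ E} {s : E ⟶ B} {r : B ⟶ A}
    (h : Spl f g s r) : Spl s r f g :=
  ⟨h.sg, h.fr, h.sr, h.fg, by rw [add_comm]; exact h.tot⟩

/-- complementary iso -/
theorem Spl.compl {X Y M W L : D} {f : Y ⟶ L} {g : L ⟶ X} {s : X ⟶ L} {r : L ⟶ Y}
    {m : M ⟶ L} {n : L ⟶ W} {s' : W ⟶ L} {r' : L ⟶ M}
    (h : Spl f g s r) (h' : Spl m n s' r') [IsIso (f ≫ n)] : IsIso (m ≫ g) := by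
  -- the inverse is the projection of `s` to the kernel of `n` along `f`
  have key : ∀ {T : D} (x : T ⟶ L), x ≫ n = 0 → (x ≫ r') ≫ m = x := by
    intro T x hx
    have := congrArg (fun z => x ≫ z) h'.tot
    simpa [reassoc_of% hx] using this
  have key2 : ∀ {T : D} (x : T ⟶ L), x ≫ g = 0 → (x ≫ r) ≫ f = x := by
    intro T x hx
    have := congrArg (fun z => x ≫ z) h.tot
    simpa [reassoc_of% hx] using this
  have hmn := h'.fg
  have hmr := h'.fr
  let c : X ⟶ L := s - s ≫ n ≫ inv (f ≫ n) ≫ f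
  have hcn : c ≫ n = 0 := by simp [c]
  have hcg : c ≫ g = 𝟙 X := by simp [c, h.sg, h.fg]
  refine ⟨c ≫ r', ?_, ?_⟩
  · have h1 : m ≫ g ≫ c = m := by
      have hx : (m ≫ g ≫ c - m) ≫ g = 0 := by simp [hcg]
      have h2 := key2 _ hx
      have h3 : (m ≫ g ≫ c - m) ≫ n = 0 := by simp [hcn, hmn]
      rw [← h2, Category.assoc, ] at h3
      have h4 := (Preadditive.IsIso.comp_right_eq_zero _ (f ≫ n)).1 h3
      rw [h4, zero_comp] at h2
      exact sub_eq_zero.mp h2.symm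
    rw [Category.assoc, ← Category.assoc g, ← Category.assoc m, h1, hmr]
  · rw [← Category.assoc, key c hcn, hcg]

/-- counting lemma: exactness and cardinality give surjectivity -/
theorem exists_section_s14 (hHom : ∀ A B : D, Finite (A ⟶ B)) [HasBinaryBiproducts D]
    {A B E : D} (f : A ⟶ B) (g : B ⟶ E) (φ : B ≅ A ⊞ E)
    (hex : ∀ x : E ⟶ B, x ≫ g = 0 → ∃ y : E ⟶ A, x = y ≫ f) : ∃ s : E ⟶ B, s ≫ g = 𝟙 E := by
  have := hHom
  let G : (E ⟶ B) →+ (E ⟶ E) :=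
    { toFun := fun x => x ≫ g, map_zero' := by simp, map_add' := by simp }
  have h1 : Nat.card (E ⟶ B) = Nat.card (E ⟶ A) * Nat.card (E ⟶ E) := by
    rw [← Nat.card_prod]
    exact Nat.card_congr
      { toFun := fun x => (x ≫ φ.hom ≫ biprod.fst, x ≫ φ.hom ≫ biprod.snd)
        invFun := fun y => biprod.lift y.1 y.2 ≫ φ.inv
        left_inv := fun x => by
          rw [← cancel_mono φ.hom]
          ext <;> simp
        right_inv := fun y => by simp }
  have h2 : Nat.card G.ker ≤ Nat.card (E ⟶ A) := by
    have hx : ∀ x : G.ker, ∃ y : E ⟶ A, x.1 = y ≫ f := fun x => hex x.1 x.2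
    choose y hy using hx
    refine Nat.card_le_card_of_injective y ?_
    intro a b hab
    apply Subtype.ext
    rw [hy a, hy b, hab]
  have h3 : Function.Surjective G := by
    apply AddMonoidHom.surjective_of_card_ker_le_div
    rw [h1, Nat.mul_div_cancel _ Nat.card_pos]
    exact h2
  exact h3 (𝟙 E)

end aux

theorem spl_of_dist (hHom : ∀ A B : C, Finite (A ⟶ B)) {A B E : C} (f : A ⟶ B) (g : B ⟶ E)
    (h : E ⟶ A⟦(1 : ℤ)⟧) (hT : Triangle.mk f g h ∈ distTriang C) (φ : B ≅ A ⊞ E) :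
    h = 0 ∧ ∃ s r, Spl f g s r := by
  have hfg : f ≫ g = 0 := comp_distTriang_mor_zero₁₂ _ hT
  have hgh : g ≫ h = 0 := comp_distTriang_mor_zero₂₃ _ hT
  have hex : ∀ {T : C} (x : T ⟶ B), x ≫ g = 0 → ∃ y : T ⟶ A, x = y ≫ f :=
    fun x hx => Triangle.coyoneda_exact₂ _ hT x hx
  obtain ⟨s, hs⟩ := exists_section_s14 hHom f g φ (fun x hx => hex x hx)
  have h0 : h = 0 := by
    rw [← Category.id_comp h, ← hs, Category.assoc, hgh, comp_zero]
  have hmono : Mono f := Triangle.mono₁ _ hT h0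
  refine ⟨h0, s, ?_⟩
  obtain ⟨r, hr⟩ := hex (𝟙 B - g ≫ s) (by simp [hs])
  refine ⟨r, ?_, hs, hfg, ?_, ?_⟩
  · rw [← cancel_mono f, Category.assoc, ← hr]; simp [reassoc_of% hfg]
  · rw [← cancel_mono f, Category.assoc, ← hr]; simp [reassoc_of% hs]
  · rw [← hr]; simp

/-- Normal form of a pair. -/
theorem pair_nf (hHom : ∀ A B : C, Finite (A ⟶ B))
    (X Y Z M : C) (hX : Indecomposable X) (hY : Indecomposable Y)
    (hZ : Indecomposable Z)
    (hMY : ¬ Nonempty (M ≅ Y))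
    (hL : Nonempty ((M ⊞ (Z⟦(1 : ℤ)⟧) : C) ≅ X ⊞ Y))
    (p : WT X Y (M ⊞ (Z⟦(1 : ℤ)⟧)) × WT (M ⊞ (Z⟦(1 : ℤ)⟧)) Z M) :
    p.1.1.2.2 = 0 ∧ p.2.1.1 = 0 ∧ p.1.1.1 ≫ p.1.1.2.1 = 0 ∧ p.2.1.2.1 ≫ p.2.1.2.2 = 0 ∧
    IsIso (p.1.1.1 ≫ p.2.1.2.2) ∧
    ∃ _ : IsIso (p.2.1.2.1 ≫ p.1.1.2.1), ∃ r, Spl p.1.1.1 p.1.1.2.1 (inv (p.2.1.2.1 ≫ p.1.1.2.1) ≫ p.2.1.2.1) r := by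
  obtain ⟨⟨⟨f, g, h⟩, hT⟩, ⟨⟨l, m, n⟩, hT'⟩⟩ := p
  dsimp only at hT hT' ⊢
  obtain ⟨φ⟩ := hL
  obtain ⟨h0, s, r, S⟩ := spl_of_dist hHom f g h hT (φ ≪≫ biprod.braiding X Y)
  have hR := rot_of_distTriang _ hT'
  obtain ⟨l0, s', r', S'⟩ := spl_of_dist hHom m n _ hR (Iso.refl _)
  have l0' : l = 0 := by
    apply (shiftFunctor C (1 : ℤ)).map_injective
    rw [Functor.map_zero]
    exact neg_eq_zero.mp l0
  have idX := fun e => idem_of_indecomposable hX e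
  have idY := fun e => idem_of_indecomposable hY e
  have idZ : ∀ e : Z⟦(1 : ℤ)⟧ ⟶ Z⟦(1 : ℤ)⟧, e ≫ e = e → e = 0 ∨ e = 𝟙 _ := by
    intro e he
    obtain ⟨e', rfl⟩ := (shiftFunctor C (1 : ℤ)).map_surjective e
    rcases idem_of_indecomposable hZ e'
      ((shiftFunctor C (1 : ℤ)).map_injective (by simpa using he)) with h | h
    · left; simp [h]
    · right; simp [h]
  have hTZ : ¬ IsZero (Z⟦(1 : ℤ)⟧) := by
    intro hz
    apply hZ.1
    rw [IsZero.iff_id_eq_zero]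
    apply (shiftFunctor C (1 : ℤ)).map_injective
    exact hz.eq_of_src _ _
  have hsum : s' ≫ r ≫ f ≫ n + s' ≫ g ≫ s ≫ n = 𝟙 _ := by
    have := congrArg (fun z => s' ≫ z ≫ n) S.tot
    simpa [S'.sg] using this
  have : Finite (End (Z⟦(1 : ℤ)⟧)) := hHom _ _
  have hiso : IsIso (f ≫ n) := by
    rcases isUnit_or_of_add (R := End (Z⟦(1 : ℤ)⟧)) (fun e he => idZ e he) _ _ hsum with hu | hu
    · rw [isUnit_iff_isIso] at hu
      exact isIso_of_splitEpi_s14 idY hTZ (inv (s' ≫ r ≫ f ≫ n) ≫ s' ≫ r) (f ≫ n) (by simp)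
    · exfalso
      rw [isUnit_iff_isIso] at hu
      have : IsIso (s ≫ n) :=
        isIso_of_splitEpi_s14 idX hTZ (inv (s' ≫ g ≫ s ≫ n) ≫ s' ≫ g) (s ≫ n) (by simp)
      have := Spl.compl S.flip S'
      exact hMY ⟨asIso (m ≫ r)⟩
  have hiso' : IsIso (m ≫ g) := Spl.compl S S'
  refine ⟨h0, l0', S.fg, S'.fg, hiso, hiso', ?_⟩
  have hsg := S.sg
  have hfg := S.fg
  have hfr := S.fr
  have hmono : Mono f := ⟨fun a b hab => by
    have := congrArg (fun z => z ≫ r) hab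
    simpa [hfr] using this⟩
  have htot := S.tot
  -- correct `r`
  let c := inv (m ≫ g) ≫ m
  have hc : c ≫ g = 𝟙 _ := by simp [c]
  have e1 : (𝟙 _ - g ≫ c) ≫ r ≫ f = 𝟙 _ - g ≫ c := by
    rw [eq_sub_iff_add_eq.mpr htot]
    simp [reassoc_of% hc]
  refine ⟨(𝟙 _ - g ≫ c) ≫ r, ?_, hc, S.fg, ?_, ?_⟩
  · simp [reassoc_of% hfg, hfr]
  · change c ≫ _ = 0
    simp [reassoc_of% hc]
  · change _ + g ≫ c = _
    rw [Category.assoc, e1]; simp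

theorem pair_rel (hHom : ∀ A B : C, Finite (A ⟶ B))
    (X Y Z M : C) (hX : Indecomposable X) (hY : Indecomposable Y)
    (hZ : Indecomposable Z)
    (hMY : ¬ Nonempty (M ≅ Y))
    (hL : Nonempty ((M ⊞ (Z⟦(1 : ℤ)⟧) : C) ≅ X ⊞ Y))
    (p q : WT X Y (M ⊞ (Z⟦(1 : ℤ)⟧)) × WT (M ⊞ (Z⟦(1 : ℤ)⟧)) Z M) :
    PairRelT X Y Z (M ⊞ (Z⟦(1 : ℤ)⟧)) M p q := by
  obtain ⟨a1, a2, a3, a4, a5, a6, r, S⟩ := pair_nf hHom X Y Z M hX hY hZ hMY hL p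
  obtain ⟨b1, b2, b3, b4, b5, b6, t, U⟩ := pair_nf hHom X Y Z M hX hY hZ hMY hL q
  obtain ⟨⟨⟨f, g, h⟩, hT⟩, ⟨⟨l, m, n⟩, hT'⟩⟩ := p
  obtain ⟨⟨⟨f', g', h'⟩, hU⟩, ⟨⟨l', m', n'⟩, hU'⟩⟩ := q
  dsimp only at *
  subst a1 a2 b1 b2
  have hfr := S.fr
  have hfr' := U.fr
  have hmr : m ≫ r = 0 := by
    have := S.sr
    rwa [Category.assoc, Preadditive.IsIso.comp_left_eq_zero] at this
  have hmr' : m' ≫ t = 0 := by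
    have := U.sr
    rwa [Category.assoc, Preadditive.IsIso.comp_left_eq_zero] at this
  -- the automorphism of `L`
  let lam : (M ⊞ (Z⟦(1 : ℤ)⟧)) ≅ (M ⊞ (Z⟦(1 : ℤ)⟧)) :=
    { hom := r ≫ f' + g ≫ inv (m ≫ g) ≫ m'
      inv := t ≫ f + g' ≫ inv (m' ≫ g') ≫ m
      hom_inv_id := by
        have := S.tot
        simp only [Preadditive.add_comp, Preadditive.comp_add, Category.assoc,
          reassoc_of% hfr', reassoc_of% b3, reassoc_of% hmr', zero_comp, comp_zero, add_zero,
          zero_add]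
        rw [← Category.assoc m', IsIso.hom_inv_id_assoc, ← this]
      inv_hom_id := by
        have := U.tot
        simp only [Preadditive.add_comp, Preadditive.comp_add, Category.assoc,
          reassoc_of% hfr, reassoc_of% a3, reassoc_of% hmr, zero_comp, comp_zero, add_zero,
          zero_add]
        rw [← Category.assoc m, IsIso.hom_inv_id_assoc, ← this] }
  have hf : f ≫ lam.hom = f' := by simp [lam, reassoc_of% hfr, reassoc_of% a3]
  have hm : m ≫ lam.hom = m' := by
    simp only [lam, Preadditive.comp_add, reassoc_of% hmr, zero_comp, zero_add]
    rw [← Category.assoc m, IsIso.hom_inv_id_assoc]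
  clear_value lam
  have ext' : ∀ {T : C} (x y : (M ⊞ (Z⟦(1 : ℤ)⟧)) ⟶ T), f ≫ x = f ≫ y → m ≫ x = m ≫ y →
      x = y := by
    intro T x y h1 h2
    rw [← Category.id_comp x, ← Category.id_comp y, ← S.tot]
    simp [h1, h2]
  let ζ : Z ≅ Z := (shiftFunctor C (1 : ℤ)).preimageIso
    ((asIso (f ≫ n)).symm ≪≫ asIso (f' ≫ n'))
  have hζ : (shiftFunctor C (1 : ℤ)).map ζ.hom = inv (f ≫ n) ≫ f' ≫ n' := by simp [ζ]
  refine ⟨(asIso (m ≫ g)).symm ≪≫ asIso (m' ≫ g'), Iso.refl _, ζ, lam, ?_, ?_, ?_, ?_, ?_, ?_⟩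
  · dsimp only
    simp [hf]
  · dsimp only
    refine (Iso.eq_inv_comp lam).2 ?_
    apply ext'
    · rw [reassoc_of% hf, b3, reassoc_of% a3, zero_comp]
    · rw [reassoc_of% hm, ← Category.assoc m]
      simp
  · simp
  · simp
  · exact hm.symm
  · dsimp only
    rw [hζ]
    refine (Iso.eq_inv_comp lam).2 ?_
    apply ext'
    · rw [reassoc_of% hf, ← Category.assoc f, IsIso.hom_inv_id_assoc]
    · rw [reassoc_of% hm, b4, reassoc_of% a4, zero_comp]

theorem pair_nonempty (X Y Z M : C) (hL : Nonempty ((M ⊞ (Z⟦(1 : ℤ)⟧) : C) ≅ X ⊞ Y)) :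
    Nonempty (WT X Y (M ⊞ (Z⟦(1 : ℤ)⟧)) × WT (M ⊞ (Z⟦(1 : ℤ)⟧)) Z M) := by
  obtain ⟨φ⟩ := hL
  refine ⟨⟨⟨(biprod.inr ≫ φ.inv, φ.hom ≫ biprod.fst, 0), ?_⟩, ⟨(0, biprod.inl, biprod.snd), ?_⟩⟩⟩
  · refine isomorphic_distinguished _ (binaryBiproductTriangle_distinguished Y X) _ ?_
    exact Triangle.isoMk _ _ (Iso.refl _) (φ ≪≫ biprod.braiding X Y) (Iso.refl _)
      (show (biprod.inr ≫ φ.inv) ≫ (φ ≪≫ biprod.braiding X Y).hom = 𝟙 Y ≫ biprod.inl by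
        ext <;> simp)
      (show (φ.hom ≫ biprod.fst) ≫ 𝟙 X = (φ ≪≫ biprod.braiding X Y).hom ≫ biprod.snd by simp)
      (show (0 : X ⟶ Y⟦(1 : ℤ)⟧) ≫ (shiftFunctor C (1 : ℤ)).map (𝟙 Y) = 𝟙 X ≫ 0 by simp)
  · rw [rotate_distinguished_triangle]
    refine isomorphic_distinguished _
      (binaryBiproductTriangle_distinguished M (Z⟦(1 : ℤ)⟧)) _ ?_
    exact Triangle.isoMk _ _ (Iso.refl _) (Iso.refl _) (Iso.refl _)
      (show biprod.inl ≫ 𝟙 (M ⊞ (Z⟦(1 : ℤ)⟧)) = 𝟙 M ≫ biprod.inl by simp)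
      (show biprod.snd ≫ 𝟙 (Z⟦(1 : ℤ)⟧) = 𝟙 (M ⊞ (Z⟦(1 : ℤ)⟧)) ≫ biprod.snd by simp)
      (show (-(shiftFunctor C (1 : ℤ)).map (0 : Z ⟶ M)) ≫ (shiftFunctor C (1 : ℤ)).map (𝟙 M) =
        𝟙 (Z⟦(1 : ℤ)⟧) ≫ 0 by simp)

/-- Lemma 4(2)(i): for `X, Y, Z` indecomposable, `M` nonzero with `M ≇ Y`,
`L = M ⊞ TZ` and `L ≅ X ⊞ Y`, the group `Aut(X,Y,Z,L)` acts transitively on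
`W_{XY}^L × W_{LZ}^M`; that is, `N_{XYZ}^{LM} = 1`. -/
theorem pair_orbit_transitive (hHom : ∀ A B : C, Finite (A ⟶ B))
    (X Y Z M : C) (hX : Indecomposable X) (hY : Indecomposable Y)
    (hZ : Indecomposable Z) (hM : ¬ IsZero M)
    (hMY : ¬ Nonempty (M ≅ Y))
    (hL : Nonempty ((M ⊞ (Z⟦(1 : ℤ)⟧) : C) ≅ X ⊞ Y)) :
    (∀ p q : WT X Y (M ⊞ (Z⟦(1 : ℤ)⟧)) × WT (M ⊞ (Z⟦(1 : ℤ)⟧)) Z M,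
        PairRelT X Y Z (M ⊞ (Z⟦(1 : ℤ)⟧)) M p q) ∧
    Nat.card (Quot (PairRelT X Y Z (M ⊞ (Z⟦(1 : ℤ)⟧)) M)) = 1 := by
  have hrel := pair_rel hHom X Y Z M hX hY hZ hMY hL
  refine ⟨hrel, ?_⟩
  rw [Nat.card_eq_one_iff_unique]
  obtain ⟨p⟩ := pair_nonempty X Y Z M hL
  refine ⟨⟨fun a b => ?_⟩, ⟨Quot.mk _ p⟩⟩
  induction a using Quot.ind
  induction b using Quot.ind
  exact Quot.sound (hrel _ _)

end HallTri
end
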